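/- For all integers k and m with m ≥ k ≥ 4, there exists a finite simple graph G such that cr(G) = k and rcr(G) ≥ m. -/

import Mathlib

open Set

noncomputable section

abbrev Plane : Type := ℝ × ℝ

/-- The setoid on nonzero vectors of `ℝ³` identifying nonzero scalar multiples. -/
def projSetoid : Setoid {v : Fin 3 → ℝ // v ≠ 0} where
  r v w := ∃ c : ℝ, c ≠ 0 ∧ c • v.1 = w.1
  iseqv := by
    constructor
    · exact fun v => ⟨1, one_ne_zero, one_smul _ _⟩
    · rintro v w ⟨c, hc, h⟩
      exact ⟨c⁻¹, inv_ne_zero hc, by rw [← h, smul_smul, inv_mul_cancel₀ hc, one_smul]⟩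
    · rintro u v w ⟨c, hc, h⟩ ⟨d, hd, h'⟩
      exact ⟨d * c, mul_ne_zero hd hc, by rw [← h', ← h, smul_smul]⟩

/-- The real projective plane, as the quotient of `ℝ³ \ {0}` by nonzero scaling. -/
def RP2 : Type := Quotient projSetoid

instance : TopologicalSpace RP2 := instTopologicalSpaceQuotient

/-- The standard affine embedding of the plane in the projective plane. -/
def planeToRP2 (p : Plane) : RP2 :=
  Quotient.mk projSetoid ⟨![p.1, p.2, 1], by
    intro h
    simpa using congrFun h 2⟩

/-- A pseudoline: a simple closed curve in the projective plane that does not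
disconnect it. -/
def IsPseudoline (L : Set RP2) : Prop :=
  ∃ f : AddCircle (1 : ℝ) → RP2,
    Continuous f ∧ Function.Injective f ∧ Set.range f = L ∧ IsConnected Lᶜ

/-- A drawing of a graph in the plane: vertices are distinct points, each edge is a
simple arc (parametrized on `[0,1]`) joining its endpoints, and no arc passes
through a vertex other than its endpoints. -/
structure Drawing {V : Type*} (G : SimpleGraph V) where
  vert : V → Plane
  vert_inj : Function.Injective vert
  arc : G.edgeSet → ℝ → Plane
  arc_cont : ∀ e, ContinuousOn (arc e) (Icc 0 1)
  arc_injOn : ∀ e, InjOn (arc e) (Icc 0 1)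
  arc_ends : ∀ e : G.edgeSet, ∃ x y : V,
    (e : Sym2 V) = s(x, y) ∧ arc e 0 = vert x ∧ arc e 1 = vert y
  arc_avoid : ∀ (e : G.edgeSet) (t : ℝ), t ∈ Icc (0:ℝ) 1 →
    (∃ v, arc e t = vert v) → t = 0 ∨ t = 1

namespace Drawing

variable {V : Type*} {G : SimpleGraph V} (D : Drawing G)

/-- The interior (relative to its endpoints) of the arc of an edge. -/
def interOf (e : G.edgeSet) : Set Plane := D.arc e '' Ioo 0 1

/-- The set of crossings of a drawing: pairs consisting of a point of the plane
together with an (unordered) pair of distinct edges whose interiors both pass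
through the point. -/
def CrossSet : Set (Plane × Sym2 G.edgeSet) :=
  { x | ∃ e f : G.edgeSet, e ≠ f ∧ x.2 = s(e, f) ∧
      x.1 ∈ D.interOf e ∧ x.1 ∈ D.interOf f }

/-- The weighted number of crossings of a drawing: each crossing of a pair of
edges `e`, `f` contributes `w e * w f`. -/
def wcount (w : Sym2 V → ℕ) : ℕ :=
  ∑ᶠ x ∈ D.CrossSet,
    Sym2.lift ⟨fun e f : G.edgeSet => w e * w f, fun e f => mul_comm _ _⟩ x.2

/-- A drawing is pseudolinear if each edge can be extended to a pseudoline of the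
projective plane (via the standard affine embedding of the plane in the projective
plane) so that the extensions form a pseudoline arrangement: any two of the
pseudolines extending distinct edges meet in exactly one point. -/
def IsPseudolinear : Prop :=
  ∃ L : G.edgeSet → Set RP2,
    (∀ e, IsPseudoline (L e)) ∧
    (∀ e, ∀ t ∈ Icc (0:ℝ) 1, planeToRP2 (D.arc e t) ∈ L e) ∧
    (∀ e f, e ≠ f → ∃! p, p ∈ L e ∧ p ∈ L f)

/-- A drawing is rectilinear if every edge is drawn as a straight line segment. -/
def IsRectilinear : Prop :=
  ∀ e, ∀ t ∈ Icc (0:ℝ) 1, D.arc e t = (1 - t) • D.arc e 0 + t • D.arc e 1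

/-- A drawing is x-monotone if every edge meets every vertical line in at most one
point. -/
def IsMonotone : Prop :=
  ∀ e, InjOn (fun t => (D.arc e t).1) (Icc 0 1)

end Drawing

/-- The crossing number of `G` relative to a class of drawings `P`: the minimum
number of crossings in a drawing of `G` satisfying `P` (with finitely many
crossings). -/
def crNumP {V : Type*} (G : SimpleGraph V) (P : Drawing G → Prop) : ℕ :=
  sInf { n | ∃ D : Drawing G, P D ∧ D.CrossSet.Finite ∧ D.CrossSet.ncard = n }

/-- The crossing number `cr G`. -/
def crNum {V : Type*} (G : SimpleGraph V) : ℕ := crNumP G fun _ => True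

/-- The pseudolinear crossing number `pcr G`. -/
def pcrNum {V : Type*} (G : SimpleGraph V) : ℕ := crNumP G Drawing.IsPseudolinear

/-- The rectilinear crossing number `rcr G`. -/
def rcrNum {V : Type*} (G : SimpleGraph V) : ℕ := crNumP G Drawing.IsRectilinear

/-- The monotone crossing number `mon-cr G`. -/
def moncrNum {V : Type*} (G : SimpleGraph V) : ℕ := crNumP G Drawing.IsMonotone

/-- The weighted crossing number of `(G, w)` relative to a class of drawings. -/
def wcrNumP {V : Type*} (G : SimpleGraph V) (w : Sym2 V → ℕ) (P : Drawing G → Prop) : ℕ :=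
  sInf { n | ∃ D : Drawing G, P D ∧ D.CrossSet.Finite ∧ D.wcount w = n }

/-- The weighted crossing number `cr (G, w)`. -/
def wcrNum {V : Type*} (G : SimpleGraph V) (w : Sym2 V → ℕ) : ℕ :=
  wcrNumP G w fun _ => True

/-- The weighted pseudolinear crossing number `pcr (G, w)`. -/
def wpcrNum {V : Type*} (G : SimpleGraph V) (w : Sym2 V → ℕ) : ℕ :=
  wcrNumP G w Drawing.IsPseudolinear

/-- The weighted rectilinear crossing number `rcr (G, w)`. -/
def wrcrNum {V : Type*} (G : SimpleGraph V) (w : Sym2 V → ℕ) : ℕ :=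
  wcrNumP G w Drawing.IsRectilinear

theorem exists_continuous_log {A : Type*} [TopologicalSpace A] [SimplyConnectedSpace A]
    [LocallyPathConnectedSpace A] (f : C(A, ℂ)) (hf : ∀ a, f a ≠ 0) :
    ∃ F : C(A, ℂ), ∀ a, Complex.exp (F a) = f a := by
  obtain ⟨a₀⟩ : Nonempty A := inferInstance
  obtain ⟨F, ⟨-, hF⟩, -⟩ := Complex.isCoveringMapOn_exp.existsUnique_continuousMap_lifts f
    (a₀ := a₀) (e₀ := Complex.log (f a₀)) (Complex.exp_log (hf a₀)) hf
  exact ⟨F, fun a => congrFun hF a⟩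

theorem continuous_log_increment_unique {F F' : C(ℝ, ℂ)}
    (h : ∀ t, Complex.exp (F t) = Complex.exp (F' t)) : F 1 - F 0 = F' 1 - F' 0 := by
  let f : C(ℝ, ℂ) := ⟨fun t => Complex.exp (F t), by fun_prop⟩
  obtain ⟨K, -, hK⟩ := Complex.isCoveringMapOn_exp.existsUnique_continuousMap_lifts f
    (a₀ := 0) (e₀ := F 0) rfl (fun a => Complex.exp_ne_zero _)
  let F'' : C(ℝ, ℂ) := ⟨fun t => F' t + (F 0 - F' 0), by fun_prop⟩
  have h1 := hK F ⟨rfl, rfl⟩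
  have h2 := hK F'' ⟨by simp [F''], by
    ext t
    simp only [Function.comp_apply, F'', f, ContinuousMap.coe_mk]
    rw [Complex.exp_add, Complex.exp_sub, ← h 0, div_self (Complex.exp_ne_zero _), mul_one, h t]⟩
  have h3 : F 1 = F' 1 + (F 0 - F' 0) := congrArg (fun K : C(ℝ, ℂ) => K 1) (h1.trans h2.symm)
  rw [h3]; ring

/-- `+1` or `-1` according to whether `x < y`. -/
def orderSign (x y : Fin 5) : ℤ := if x < y then 1 else -1

/-- The complete graph on five vertices is not planar, for drawings whose edges are arbitrary
continuous curves: two independent edges meet. -/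
theorem exists_independent_curves_meet (P : Fin 5 → ℂ) (g : Fin 5 → Fin 5 → C(ℝ, ℂ))
    (h0 : ∀ i j, i < j → g i j 0 = P i) (h1 : ∀ i j, i < j → g i j 1 = P j) :
    ∃ i j k l : Fin 5, i < j ∧ k < l ∧ i ≠ k ∧ i ≠ l ∧ j ≠ k ∧ j ≠ l ∧
      ∃ s t, g i j s = g k l t := by
  by_contra! hcon
  have havoid : ∀ c i j : Fin 5, i < j → c ≠ i → c ≠ j → ∀ t, g i j t - P c ≠ 0 := by
    intro c i j hij hci hcj t
    obtain ⟨d, hdi, hdj, hdc⟩ : ∃ d : Fin 5, d ≠ i ∧ d ≠ j ∧ d ≠ c := by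
      clear hcon h0 h1
      revert c i j; decide
    rw [sub_ne_zero]
    rcases lt_or_gt_of_ne hdc with h | h
    · rw [← h1 d c h]
      exact hcon i j d c hij h hdi.symm hci.symm hdj.symm hcj.symm t 1
    · rw [← h0 c d h]
      exact hcon i j c d hij h hci.symm hdi.symm hcj.symm hdj.symm t 0
  have hlift : ∀ c i j : Fin 5, ∃ F : C(ℝ, ℂ), i < j → c ≠ i → c ≠ j →
      ∀ t, Complex.exp (F t) = g i j t - P c := by
    intro c i j
    by_cases h : i < j ∧ c ≠ i ∧ c ≠ j
    · obtain ⟨F, hF⟩ := exists_continuous_log (⟨fun t => g i j t - P c, by fun_prop⟩ : C(ℝ, ℂ))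
        (havoid c i j h.1 h.2.1 h.2.2)
      exact ⟨F, fun _ _ _ => hF⟩
    · exact ⟨0, fun h1 h2 h3 => absurd ⟨h1, h2, h3⟩ h⟩
  choose F hF using hlift
  have hP : ∀ x y : Fin 5, x < y → P y - P x ≠ 0 := by
    intro x y hxy
    obtain ⟨d, hd⟩ : ∃ d : Fin 5, (y < d ∧ d ≠ x) ∨ (d < y ∧ d ≠ x) := by
      clear hcon h0 h1 hF
      revert x y; decide
    rcases hd with ⟨h, h'⟩ | ⟨h, h'⟩
    · rw [← h0 y d h]; exact havoid x y d h hxy.ne h'.symm 0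
    · rw [← h1 d y h]; exact havoid x d y h h'.symm hxy.ne 1
  let A : Fin 5 → Fin 5 → ℂ := fun x y =>
    if x < y then Complex.log (P y - P x) else Complex.log (P x - P y) + Real.pi * Complex.I
  have hA : ∀ x y, x ≠ y → Complex.exp (A x y) = P y - P x := by
    intro x y hxy
    rcases lt_or_gt_of_ne hxy with h | h
    · simp only [A, if_pos h, Complex.exp_log (hP x y h)]
    · simp only [A, if_neg h.not_gt, Complex.exp_add, Complex.exp_log (hP y x h),
        Complex.exp_pi_mul_I]
      ring
  have hAs : ∀ x y, x ≠ y → A x y - A y x = -(orderSign x y) * (Real.pi * Complex.I) := by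
    intro x y hxy
    rcases lt_or_gt_of_ne hxy with h | h
    · simp only [A, orderSign, if_pos h, if_neg h.not_gt]; push_cast; ring
    · simp only [A, orderSign, if_pos h, if_neg h.not_gt]; push_cast; ring
  have hn : ∀ c i j : Fin 5, ∃ n : ℤ, i < j → c ≠ i → c ≠ j →
      F c i j 1 - F c i j 0 = A c j - A c i + n * (2 * Real.pi * Complex.I) := by
    intro c i j
    by_cases h : i < j ∧ c ≠ i ∧ c ≠ j
    · obtain ⟨h, hi, hj⟩ := h
      have : Complex.exp (F c i j 1 - F c i j 0) = Complex.exp (A c j - A c i) := by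
        rw [Complex.exp_sub, Complex.exp_sub, hF c i j h hi hj, hF c i j h hi hj,
          hA c j hj, hA c i hi, h0 i j h, h1 i j h]
      obtain ⟨n, hn⟩ := Complex.exp_eq_exp_iff_exists_int.1 this
      exact ⟨n, fun _ _ _ => hn⟩
    · exact ⟨0, fun h1 h2 h3 => absurd ⟨h1, h2, h3⟩ h⟩
  choose n hn using hn
  have key : ∀ i j k l : Fin 5, i < j → k < l → i ≠ k → i ≠ l → j ≠ k → j ≠ l →
      2 * (n k i j + n j k l - n i k l - n l i j) =
        orderSign k j + orderSign j l + orderSign l i + orderSign i k := by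
    intro i j k l hij hkl hik hil hjk hjl
    obtain ⟨G, hG⟩ := exists_continuous_log
      (⟨fun x => g i j x.1 - g k l x.2, by fun_prop⟩ : C(ℝ × ℝ, ℂ))
      (fun x => sub_ne_zero.2 (hcon i j k l hij hkl hik hil hjk hjl x.1 x.2))
    simp only [ContinuousMap.coe_mk] at hG
    have e1 := continuous_log_increment_unique (F := F k i j)
      (F' := ⟨fun s => G (s, 0), by fun_prop⟩) (fun t => by
        simp [hF k i j hij hik.symm hjk.symm, hG, h0 k l hkl])
    have e2 := continuous_log_increment_unique (F := F l i j)
      (F' := ⟨fun s => G (s, 1), by fun_prop⟩) (fun t => by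
        simp [hF l i j hij hil.symm hjl.symm, hG, h1 k l hkl])
    have e3 := continuous_log_increment_unique (F := F i k l)
      (F' := ⟨fun t => G (0, t) + Real.pi * Complex.I, by fun_prop⟩) (fun t => by
        simp [hF i k l hkl hik hil, hG, h0 i j hij, Complex.exp_add])
    have e4 := continuous_log_increment_unique (F := F j k l)
      (F' := ⟨fun t => G (1, t) + Real.pi * Complex.I, by fun_prop⟩) (fun t => by
        simp [hF j k l hkl hjk hjl, hG, h1 i j hij, Complex.exp_add])
    rw [hn k i j hij hik.symm hjk.symm] at e1
    rw [hn l i j hij hil.symm hjl.symm] at e2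
    rw [hn i k l hkl hik hil] at e3
    rw [hn j k l hkl hjk hjl] at e4
    simp only [ContinuousMap.coe_mk] at e1 e2 e3 e4
    have s1 := hAs k j hjk.symm
    have s2 := hAs j l hjl
    have s3 := hAs l i hil.symm
    have s4 := hAs i k hik
    have hpi : (Real.pi * Complex.I : ℂ) ≠ 0 := by simp [Real.pi_ne_zero]
    have : ((2 * (n k i j + n j k l - n i k l - n l i j) : ℤ) : ℂ) =
        ((orderSign k j + orderSign j l + orderSign l i + orderSign i k : ℤ) : ℂ) := by
      apply mul_right_cancel₀ hpi
      push_cast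
      linear_combination e1 + e4 - e3 - e2 - s1 - s2 - s3 - s4
    exact_mod_cast this
  have k1 := key 0 1 2 3 (by decide) (by decide) (by decide) (by decide) (by decide) (by decide)
  have k2 := key 0 1 2 4 (by decide) (by decide) (by decide) (by decide) (by decide) (by decide)
  have k3 := key 0 1 3 4 (by decide) (by decide) (by decide) (by decide) (by decide) (by decide)
  have k4 := key 0 2 1 3 (by decide) (by decide) (by decide) (by decide) (by decide) (by decide)
  have k5 := key 0 2 1 4 (by decide) (by decide) (by decide) (by decide) (by decide) (by decide)
  have k6 := key 0 2 3 4 (by decide) (by decide) (by decide) (by decide) (by decide) (by decide)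
  have k7 := key 0 3 1 2 (by decide) (by decide) (by decide) (by decide) (by decide) (by decide)
  have k8 := key 0 3 1 4 (by decide) (by decide) (by decide) (by decide) (by decide) (by decide)
  have k9 := key 0 3 2 4 (by decide) (by decide) (by decide) (by decide) (by decide) (by decide)
  have k10 := key 0 4 1 2 (by decide) (by decide) (by decide) (by decide) (by decide) (by decide)
  have k11 := key 0 4 1 3 (by decide) (by decide) (by decide) (by decide) (by decide) (by decide)
  have k12 := key 0 4 2 3 (by decide) (by decide) (by decide) (by decide) (by decide) (by decide)
  have k13 := key 1 2 3 4 (by decide) (by decide) (by decide) (by decide) (by decide) (by decide)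
  have k14 := key 1 3 2 4 (by decide) (by decide) (by decide) (by decide) (by decide) (by decide)
  have k15 := key 1 4 2 3 (by decide) (by decide) (by decide) (by decide) (by decide) (by decide)
  simp [orderSign] at k1 k2 k3 k4 k5 k6 k7 k8 k9 k10 k11 k12 k13 k14 k15
  omega

theorem exists_independent_sets_meet (P : Fin 5 → Plane) (S : Fin 5 → Fin 5 → Set Plane)
    (h : ∀ i j, i < j → JoinedIn (S i j) (P i) (P j)) :
    ∃ i j k l : Fin 5, i < j ∧ k < l ∧ i < k ∧ j ≠ k ∧ j ≠ l ∧ (S i j ∩ S k l).Nonempty := by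
  have hg : ∀ i j, ∃ g : C(ℝ, Plane), i < j → g 0 = P i ∧ g 1 = P j ∧ ∀ t, g t ∈ S i j := by
    intro i j
    by_cases hij : i < j
    · refine ⟨⟨(h i j hij).somePath.extend, (h i j hij).somePath.continuous_extend⟩, fun _ => ?_⟩
      refine ⟨by simp, by simp, fun t => ?_⟩
      have : (h i j hij).somePath.extend t ∈ range (h i j hij).somePath.extend := ⟨t, rfl⟩
      rw [Path.extend_range] at this
      obtain ⟨s, hs⟩ := this
      change (h i j hij).somePath.extend t ∈ _
      rw [← hs]
      exact (h i j hij).somePath_mem s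
    · exact ⟨⟨fun _ => P i, continuous_const⟩, fun h' => absurd h' hij⟩
  choose g hg using hg
  let E := Complex.equivRealProdCLM.symm
  obtain ⟨i, j, k, l, hij, hkl, hik, hil, hjk, hjl, s, t, hst⟩ :=
    exists_independent_curves_meet (fun i => E (P i))
      (fun i j => ⟨fun t => E (g i j t), by fun_prop⟩)
      (fun i j hij => by simp [(hg i j hij).1]) (fun i j hij => by simp [(hg i j hij).2.1])
  have hst' : g i j s = g k l t := E.injective hst
  rcases lt_or_gt_of_ne hik with hik' | hik'
  · exact ⟨i, j, k, l, hij, hkl, hik', hjk, hjl, _, (hg i j hij).2.2 s,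
      hst' ▸ (hg k l hkl).2.2 t⟩
  · exact ⟨k, l, i, j, hkl, hij, hik', hil.symm, hjl.symm, _, (hg k l hkl).2.2 t,
      hst' ▸ (hg i j hij).2.2 s⟩

theorem independent_pairs (R : Fin 5 → Fin 5 → Fin 5 → Fin 5 → Prop)
    (h : (R 0 1 2 3 ∧ R 0 1 2 4 ∧ R 0 1 3 4) ∧ (R 0 2 1 3 ∧ R 0 2 1 4 ∧ R 0 2 3 4) ∧
      (R 0 3 1 2 ∧ R 0 3 1 4 ∧ R 0 3 2 4) ∧ (R 0 4 1 2 ∧ R 0 4 1 3 ∧ R 0 4 2 3) ∧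
      (R 1 2 3 4 ∧ R 1 3 2 4 ∧ R 1 4 2 3)) (i j k l : Fin 5) (hij : i < j) (hkl : k < l)
    (hik : i < k) (hjk : j ≠ k) (hjl : j ≠ l) : R i j k l := by
  have : ∀ i j k l : Fin 5, i < j → k < l → i < k → j ≠ k → j ≠ l →
      (i, j, k, l) ∈ [(0, 1, 2, 3), (0, 1, 2, 4), (0, 1, 3, 4), (0, 2, 1, 3), (0, 2, 1, 4),
        (0, 2, 3, 4), (0, 3, 1, 2), (0, 3, 1, 4), (0, 3, 2, 4), (0, 4, 1, 2), (0, 4, 1, 3),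
        (0, 4, 2, 3), (1, 2, 3, 4), (1, 3, 2, 4),
        ((1, 4, 2, 3) : Fin 5 × Fin 5 × Fin 5 × Fin 5)] := by
    decide +kernel
  have := this i j k l hij hkl hik hjk hjl
  simp only [List.mem_cons, Prod.mk.injEq, List.not_mem_nil, or_false] at this
  rcases this with h' | h' | h' | h' | h' | h' | h' | h' | h' | h' | h' | h' | h' | h' | h' <;>
    (obtain ⟨rfl, rfl, rfl, rfl⟩ := h'; tauto)

theorem not_independent_sets_disjoint (P : Fin 5 → Plane) (S : Fin 5 → Fin 5 → Set Plane)
    (h : ∀ i j, i < j → JoinedIn (S i j) (P i) (P j))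
    (hS : (Disjoint (S 0 1) (S 2 3) ∧ Disjoint (S 0 1) (S 2 4) ∧ Disjoint (S 0 1) (S 3 4)) ∧
      (Disjoint (S 0 2) (S 1 3) ∧ Disjoint (S 0 2) (S 1 4) ∧ Disjoint (S 0 2) (S 3 4)) ∧
      (Disjoint (S 0 3) (S 1 2) ∧ Disjoint (S 0 3) (S 1 4) ∧ Disjoint (S 0 3) (S 2 4)) ∧
      (Disjoint (S 0 4) (S 1 2) ∧ Disjoint (S 0 4) (S 1 3) ∧ Disjoint (S 0 4) (S 2 3)) ∧
      (Disjoint (S 1 2) (S 3 4) ∧ Disjoint (S 1 3) (S 2 4) ∧ Disjoint (S 1 4) (S 2 3))) :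
    False := by
  obtain ⟨i, j, k, l, hij, hkl, hik, hjk, hjl, hmeet⟩ := exists_independent_sets_meet P S h
  exact not_disjoint_iff_nonempty_inter.2 hmeet (independent_pairs
    (fun i j k l => Disjoint (S i j) (S k l)) hS i j k l hij hkl hik hjk hjl)

/-- Twice the signed area of the triangle `a b c`. -/
def area (a b c : Plane) : ℝ := (b.1 - a.1) * (c.2 - a.2) - (b.2 - a.2) * (c.1 - a.1)

theorem continuous_area (a b : Plane) : Continuous (area a b) := by
  unfold area; fun_prop

theorem area_add_smul_sub (a b p q : Plane) (t : ℝ) :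
    area a b (p + t • (q - p)) = (1 - t) * area a b p + t * area a b q := by
  simp only [area, Prod.fst_add, Prod.snd_add, Prod.smul_fst, Prod.smul_snd, Prod.fst_sub,
    Prod.snd_sub, smul_eq_mul]
  ring

theorem area_rotate (a b c : Plane) : area a b c = area b c a := by
  simp only [area]; ring

theorem area_swap (a b c : Plane) : area a b c = -area a c b := by
  simp only [area]; ring

@[simp] theorem area_self_left (a b : Plane) : area a b a = 0 := by simp [area]

@[simp] theorem area_self_right (a b : Plane) : area a b b = 0 := by simp only [area]; ring

theorem area_smul_eq (u v p z : Plane) :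
    area u v p • z = area v p z • u - area u p z • v + area u v z • p := by
  ext <;> simp only [area, Prod.fst_add, Prod.snd_add, Prod.smul_fst, Prod.smul_snd, Prod.fst_sub,
    Prod.snd_sub, smul_eq_mul] <;> ring

theorem mem_segment_iff_sub {a b z : Plane} :
    z ∈ segment ℝ a b ↔ ∃ t : ℝ, 0 ≤ t ∧ t ≤ 1 ∧ z = a + t • (b - a) := by
  rw [segment_eq_image']
  constructor
  · rintro ⟨t, ⟨h0, h1⟩, rfl⟩; exact ⟨t, h0, h1, rfl⟩
  · rintro ⟨t, h0, h1, rfl⟩; exact ⟨t, ⟨h0, h1⟩, rfl⟩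

section Wedge

variable {σ : ℝ} {u v p z : Plane}

theorem mem_segment_left (hp : 0 < σ * area u v p) (hL : σ * area u p z = 0)
    (hR : 0 ≤ σ * area v p z) (hH : 0 ≤ σ * area u v z) : z ∈ segment ℝ u p := by
  have hs : σ ≠ 0 := by rintro rfl; simp at hp
  have hD : area u v p ≠ 0 := by intro h; simp [h] at hp
  have hsum : area v p z - area u p z + area u v z = area u v p := by simp only [area]; ring
  have hL' : area u p z = 0 := by simpa [hs] using hL
  refine ⟨σ * area v p z / (σ * area u v p), σ * area u v z / (σ * area u v p),
    div_nonneg hR hp.le, div_nonneg hH hp.le, ?_, ?_⟩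
  · rw [← add_div, div_eq_one_iff_eq hp.ne', ← hsum, hL']; ring
  · have := area_smul_eq u v p z
    rw [hL', zero_smul, sub_zero] at this
    rw [mul_div_mul_left _ _ hs, mul_div_mul_left _ _ hs]
    apply smul_right_injective _ hD
    simp only [smul_add, smul_smul, mul_div_cancel₀ _ hD]
    exact this.symm

theorem mem_segment_right (hp : 0 < σ * area u v p) (hR : σ * area v p z = 0)
    (hL : σ * area u p z ≤ 0) (hH : 0 ≤ σ * area u v z) : z ∈ segment ℝ v p := by
  have e1 : area v u p = - area u v p := by simp only [area]; ring
  have e2 : area v u z = - area u v z := by simp only [area]; ring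
  refine mem_segment_left (σ := -σ) (u := v) (v := u) ?_ ?_ ?_ ?_
  · rw [e1]; linarith
  · linarith
  · linarith
  · rw [e2]; linarith

/-- A segment from `u` that ends beyond the line `v p`, below the line `u p`, meets the
segment `v p`. -/
theorem segment_inter_segment_nonempty {w : Plane} (hp : 0 < σ * area u v p)
    (hL : σ * area u p w ≤ 0) (hR : σ * area v p w ≤ 0) (hH : 0 ≤ σ * area u v w) :
    (segment ℝ u w ∩ segment ℝ v p).Nonempty := by
  have hR0 : area v p u = area u v p := (area_rotate u v p).symm
  set D := σ * area u v p with hD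
  set B := σ * area v p w with hB
  have hDB : 0 < D - B := by linarith
  have ht0 : 0 ≤ D / (D - B) := div_nonneg hp.le hDB.le
  have ht1 : D / (D - B) ≤ 1 := by rw [div_le_one hDB]; linarith
  refine ⟨u + (D / (D - B)) • (w - u), mem_segment_iff_sub.2 ⟨_, ht0, ht1, rfl⟩, ?_⟩
  refine mem_segment_right hp ?_ ?_ ?_
  · rw [area_add_smul_sub, hR0]
    have : (1 - D / (D - B)) * D + D / (D - B) * B = 0 := by field_simp; ring
    rw [hD, hB] at this ⊢
    linear_combination this
  · rw [area_add_smul_sub, area_self_left]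
    nlinarith
  · rw [area_add_smul_sub, area_self_left]
    nlinarith

end Wedge

/-- If `q` is inside the triangle `u p v`, then a connected set avoiding the segments
`u p`, `v p`, `u q`, `v q` cannot connect a point of the region between the two triangles
to a point outside the larger triangle. -/
theorem not_mem_of_isPreconnected {σ : ℝ} {u v p q w z : Plane} {C : Set Plane}
    (hC : IsPreconnected C) (hp : 0 < σ * area u v p) (hq : 0 < σ * area u v q)
    (h1 : Disjoint C (segment ℝ u p)) (h2 : Disjoint C (segment ℝ v p))
    (h3 : Disjoint C (segment ℝ u q)) (h4 : Disjoint C (segment ℝ v q))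
    (hw : w ∈ C) (hwH : 0 < σ * area u v w) (hwL : σ * area u p w < 0)
    (hwR : 0 < σ * area v p w) (hwq : 0 < σ * area u q w ∨ σ * area v q w < 0)
    (hz : z ∈ C) : 0 ≤ σ * area v p z ∧ 0 ≤ σ * area u v z := by
  by_contra hcon
  have hcont : ∀ a b : Plane, Continuous fun x => σ * area a b x := fun a b =>
    continuous_const.mul (continuous_area a b)
  let U : Set Plane := {x | 0 < σ * area u v x} ∩ {x | σ * area u p x < 0} ∩
    {x | 0 < σ * area v p x} ∩ ({x | 0 < σ * area u q x} ∪ {x | σ * area v q x < 0})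
  let V : Set Plane := ({x | σ * area u v x < 0} ∪ {x | 0 < σ * area u p x} ∪
    {x | σ * area v p x < 0}) ∪ ({x | σ * area u q x < 0} ∩ {x | 0 < σ * area v q x})
  have pos : ∀ a b : Plane, IsOpen {x | 0 < σ * area a b x} := fun a b =>
    isOpen_lt continuous_const (hcont a b)
  have neg : ∀ a b : Plane, IsOpen {x | σ * area a b x < 0} := fun a b =>
    isOpen_lt (hcont a b) continuous_const
  have hU : IsOpen U :=
    (((pos _ _).inter (neg _ _)).inter (pos _ _)).inter ((pos _ _).union (neg _ _))
  have hV : IsOpen V :=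
    (((neg _ _).union (pos _ _)).union (neg _ _)).union ((neg _ _).inter (pos _ _))
  have hcover : C ⊆ U ∪ V := by
    intro x hx
    by_contra hxUV
    have n1 := disjoint_left.1 h1 hx
    have n2 := disjoint_left.1 h2 hx
    have n3 := disjoint_left.1 h3 hx
    have n4 := disjoint_left.1 h4 hx
    simp only [U, V, mem_union, mem_inter_iff, mem_ofPred_eq, not_or, not_and, not_lt] at hxUV
    obtain ⟨hxU, ⟨⟨hH, hL⟩, hR⟩, hW⟩ := hxUV
    have hL' : σ * area u p x < 0 := lt_of_le_of_ne hL fun h => n1 (mem_segment_left hp h hR hH)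
    have hR' : 0 < σ * area v p x :=
      lt_of_le_of_ne hR fun h => n2 (mem_segment_right hp h.symm hL hH)
    have m3 : σ * area u q x = 0 → 0 ≤ σ * area v q x → False := fun h h' =>
      n3 (mem_segment_left hq h h' hH)
    have m4 : σ * area v q x = 0 → σ * area u q x ≤ 0 → False := fun h h' =>
      n4 (mem_segment_right hq h h' hH)
    have hsum : σ * area v q x - σ * area u q x + σ * area u v x = σ * area u v q := by
      simp only [area]; ring
    rcases hH.lt_or_eq with hH' | hH'
    · have := hxU ⟨⟨hH', hL'⟩, hR'⟩
      rcases this with ⟨hA, hB⟩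
      rcases hA.lt_or_eq with hA' | hA'
      · exact m4 (le_antisymm (hW hA') hB) hA
      · exact m3 hA' hB
    · have hsum' : σ * area v p x - σ * area u p x + σ * area u v x = σ * area u v p := by
        simp only [area]; ring
      have e1 : area u p x * area u v q - area u q x * area u v p =
          area u v x * area u p q := by simp only [area]; ring
      have e2 : (σ * area u p x) * (σ * area u v q) - (σ * area u q x) * (σ * area u v p) =
          (σ * area u v x) * (σ * area u p q) := by linear_combination σ ^ 2 * e1
      have e3 : area v p x * area u v q - area v q x * area u v p =
          area u v x * area v p q := by simp only [area]; ring
      have e4 : (σ * area v p x) * (σ * area u v q) - (σ * area v q x) * (σ * area u v p) =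
          (σ * area u v x) * (σ * area v p q) := by linear_combination σ ^ 2 * e3
      rw [← hH'] at e2 e4
      have f1 : σ * area u q x < 0 := by
        by_contra! hh
        nlinarith
      have f2 : 0 < σ * area v q x := by
        by_contra! hh
        nlinarith
      exact absurd (hW f1) (not_le.2 f2)
  obtain ⟨x, -, hxU, hxV⟩ := hC U V hU hV hcover
    ⟨w, hw, ⟨⟨hwH, hwL⟩, hwR⟩, hwq⟩ ⟨z, hz, by
      simp only [not_and_or, not_le] at hcon
      rcases hcon with h | h
      · exact Or.inl (Or.inr h)
      · exact Or.inl (Or.inl (Or.inl h))⟩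
  obtain ⟨⟨⟨a1, a2⟩, a3⟩, a4⟩ := hxU
  simp only [mem_ofPred_eq] at a1 a2 a3
  simp only [V, mem_union, mem_inter_iff, mem_ofPred_eq] at hxV a4
  rcases hxV with ((b | b) | b) | ⟨b, b'⟩
  · exact lt_asymm a1 b
  · exact lt_asymm a2 b
  · exact lt_asymm a3 b
  · rcases a4 with a | a
    · exact lt_asymm a b
    · exact lt_asymm a b'

theorem exists_of_mem_segment {u p x : Plane} (h : p ∈ segment ℝ u x) (hpu : p ≠ u) (hpx : p ≠ x) :
    ∃ l : ℝ, 1 < l ∧ x = u + l • (p - u) := by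
  obtain ⟨t, h0, h1, rfl⟩ := mem_segment_iff_sub.1 h
  have ht0 : t ≠ 0 := by rintro rfl; simp at hpu
  have ht1 : t ≠ 1 := by rintro rfl; simp at hpx
  have h0' : 0 < t := lt_of_le_of_ne h0 ht0.symm
  refine ⟨t⁻¹, (one_lt_inv₀ h0').2 (lt_of_le_of_ne h1 ht1), ?_⟩
  rw [add_sub_cancel_left, smul_smul, inv_mul_cancel₀ ht0, one_smul, add_sub_cancel]

/-- The crossing points `p`, `q` of two pairs of edges from `u`, `v`, on the same side
of the line `u v`, cannot be nested if the ends of the edges through `q` can be connected to a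
point outside the triangle `u p v`. -/
theorem not_nested {σ : ℝ} {u v p q yp xq z : Plane} {C : Set Plane}
    (hp : 0 < σ * area u v p) (hq : 0 < σ * area u v q)
    (hpy : p ∈ segment ℝ v yp) (hqx : q ∈ segment ℝ u xq)
    (hqx' : q ≠ xq) (hN : Disjoint (segment ℝ u xq) (segment ℝ v yp))
    (hA : σ * area u p q < 0) 
    (hC : IsPreconnected C)
    (h1 : Disjoint C (segment ℝ u p)) (h2 : Disjoint C (segment ℝ v p))
    (h3 : Disjoint C (segment ℝ u q)) (h4 : Disjoint C (segment ℝ v q))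
    (hx : xq ∈ C) (hz : z ∈ C) (hzo : σ * area v p z < 0 ∨ σ * area u v z < 0) : False := by
  have hqu : q ≠ u := by rintro rfl; simp at hq
  obtain ⟨l, hl, hxq⟩ := exists_of_mem_segment hqx hqu hqx'
  have aH : area u v xq = l * area u v q := by rw [hxq, area_add_smul_sub]; simp
  have aL : area u p xq = l * area u p q := by rw [hxq, area_add_smul_sub]; simp
  have aR : area v q xq = (1 - l) * area u v q := by
    rw [hxq, area_add_smul_sub, area_self_right, area_rotate u v q]; ring
  have bH : 0 < σ * area u v xq := by rw [aH]; nlinarith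
  have bL : σ * area u p xq < 0 := by rw [aL]; nlinarith
  have bR : 0 < σ * area v p xq := by
    by_contra! hh
    obtain ⟨x, hx1, hx2⟩ := segment_inter_segment_nonempty hp bL.le hh bH.le
    exact disjoint_left.1 hN hx1
      ((convex_segment v yp).segment_subset (left_mem_segment ℝ v yp) hpy hx2)
  have := not_mem_of_isPreconnected hC hp hq h1 h2 h3 h4 hx bH bL bR
    (Or.inr (by rw [aR]; nlinarith)) hz
  rcases hzo with h | h
  · linarith [this.1]
  · linarith [this.2]

theorem area_neg_of_beyond {σ : ℝ} {u v p x : Plane} (hp : 0 < σ * area u v p)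
    (hpx : p ∈ segment ℝ u x) (hne : p ≠ x) : σ * area v p x < 0 := by
  have hpu : p ≠ u := by rintro rfl; simp at hp
  obtain ⟨l, hl, rfl⟩ := exists_of_mem_segment hpx hpu hne
  rw [area_add_smul_sub, area_self_right, ← area_rotate u v p]
  nlinarith

theorem area_pos_of_beyond {σ : ℝ} {u v p x : Plane} (hp : 0 < σ * area u v p)
    (hpx : p ∈ segment ℝ u x) (hne : p ≠ x) : 0 < σ * area u v x := by
  have hpu : p ≠ u := by rintro rfl; simp at hp
  obtain ⟨l, hl, rfl⟩ := exists_of_mem_segment hpx hpu hne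
  rw [area_add_smul_sub, area_self_left]
  nlinarith

theorem nested_or_nested {σ : ℝ} {u v p q xp yp xq yq : Plane}
    (hp : 0 < σ * area u v p) (hq : 0 < σ * area u v q)
    (hpx : p ∈ segment ℝ u xp) (hpy : p ∈ segment ℝ v yp)
    (hqx : q ∈ segment ℝ u xq) (hqy : q ∈ segment ℝ v yq)
    (h1 : Disjoint (segment ℝ u xp) (segment ℝ v yq))
    (h2 : Disjoint (segment ℝ u xq) (segment ℝ v yp)) :
    σ * area u p q < 0 ∨ σ * area u q p < 0 := by
  by_contra! h
  have e : area u q p = -area u p q := area_swap _ _ _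
  have e' : area v q p = -area v p q := area_swap _ _ _
  rw [e] at h
  have h0 : σ * area u p q = 0 := le_antisymm (by linarith) h.1
  have sub : ∀ {a b c : Plane}, c ∈ segment ℝ a b → segment ℝ a c ⊆ segment ℝ a b :=
    fun {a b c} hc => (convex_segment a b).segment_subset (left_mem_segment ℝ a b) hc
  rcases le_total (σ * area v p q) 0 with hB | hB
  · obtain ⟨x, hx1, hx2⟩ := segment_inter_segment_nonempty hp h0.le hB hq.le
    exact disjoint_left.1 h2 (sub hqx hx1) (sub hpy hx2)
  · obtain ⟨x, hx1, hx2⟩ := segment_inter_segment_nonempty (w := p) hq (by rw [e]; linarith)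
      (by rw [e']; linarith) hp.le
    exact disjoint_left.1 h1 (sub hpx hx1) (sub hqy hx2)

theorem disjoint_segment_of_axes {p e f : Plane} (hD : e.1 * f.2 - e.2 * f.1 ≠ 0)
    {s t s' t' : ℝ} (hs : s ≠ 0) (ht : t ≠ 0) (h1 : s * s' ≤ 0) (h2 : t * t' ≤ 0) :
    Disjoint (segment ℝ (p + s • e) (p + t • f)) (segment ℝ (p + s' • e) (p + t' • f)) := by
  rw [disjoint_left]
  rintro z ⟨a, b, ha, hb, hab, rfl⟩ ⟨a', b', ha', hb', hab', h⟩
  have hx := congrArg Prod.fst h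
  have hy := congrArg Prod.snd h
  simp only [Prod.fst_add, Prod.snd_add, Prod.smul_fst, Prod.smul_snd, smul_eq_mul] at hx hy
  obtain rfl : b = 1 - a := by linarith
  obtain rfl : b' = 1 - a' := by linarith
  have e1 : a * s = a' * s' := by
    apply mul_right_cancel₀ hD
    linear_combination (-f.2) * hx + f.1 * hy
  have e2 : (1 - a) * t = (1 - a') * t' := by
    apply mul_right_cancel₀ hD
    linear_combination e.2 * hx - e.1 * hy
  have e3 : a * (s * s) ≤ 0 := by
    have : a * (s * s) = a' * (s * s') := by linear_combination s * e1
    rw [this]; exact mul_nonpos_of_nonneg_of_nonpos ha' h1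
  have e4 : (1 - a) * (t * t) ≤ 0 := by
    have : (1 - a) * (t * t) = (1 - a') * (t * t') := by linear_combination t * e2
    rw [this]; exact mul_nonpos_of_nonneg_of_nonpos hb' h2
  have := mul_self_pos.2 hs
  have := mul_self_pos.2 ht
  have : a ≤ 0 := by by_contra! hh; nlinarith
  have : 1 - a ≤ 0 := by by_contra! hh; nlinarith
  linarith

/-- The diagonals of a convex quadrilateral cannot both be replaced by disjoint connections that
avoid the other diagonal. -/
theorem not_joinedIn_of_crossing {a b c d p : Plane} {P Q : Set Plane}
    (hac : p ∈ segment ℝ a c) (hbd : p ∈ segment ℝ b d) (ha : p ≠ a) (hb : p ≠ b) (hc : p ≠ c)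
    (hd : p ≠ d) (hne : ¬ (area a c b = 0 ∧ area a c d = 0)) (hP : JoinedIn P a c)
    (hQ : JoinedIn Q b d) (hPQ : Disjoint P Q) (hPbd : Disjoint P (segment ℝ b d))
    (hQac : Disjoint Q (segment ℝ a c)) : False := by
  have seg : ∀ x y : Plane, JoinedIn (segment ℝ x y) x y := fun x y =>
    JoinedIn.of_segment_subset subset_rfl
  have subl : ∀ {x y z : Plane}, z ∈ segment ℝ x y → segment ℝ x z ⊆ segment ℝ x y :=
    fun {x y z} hz => (convex_segment x y).segment_subset (left_mem_segment ℝ x y) hz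
  have subr : ∀ {x y z : Plane}, z ∈ segment ℝ x y → segment ℝ y z ⊆ segment ℝ x y :=
    fun {x y z} hz => (convex_segment x y).segment_subset (right_mem_segment ℝ x y) hz
  have hPb := hPbd.mono_right (subl hbd)
  have hPd := hPbd.mono_right (subr hbd)
  have hQa := hQac.mono_right (subl hac)
  have hQc := hQac.mono_right (subr hac)
  obtain ⟨l, hl, hcl⟩ := exists_of_mem_segment hac ha hc
  obtain ⟨m, hm, hdm⟩ := exists_of_mem_segment hbd hb hd
  have hD : (a - p).1 * (b - p).2 - (a - p).2 * (b - p).1 ≠ 0 := by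
    intro h
    apply hne
    subst hcl hdm
    simp only [area, Prod.fst_add, Prod.snd_add, Prod.smul_fst, Prod.smul_snd, smul_eq_mul,
      Prod.fst_sub, Prod.snd_sub] at h ⊢
    constructor
    · linear_combination (-l) * h
    · linear_combination (-l) * (1 - m) * h
  have ea : a = p + (1 : ℝ) • (a - p) := by simp
  have eb : b = p + (1 : ℝ) • (b - p) := by simp
  have ec : c = p + (1 - l) • (a - p) := by rw [hcl]; module
  have ed : d = p + (1 - m) • (b - p) := by rw [hdm]; module
  have e0 : p = p + (0 : ℝ) • (a - p) := by simp
  have e0' : p = p + (0 : ℝ) • (b - p) := by simp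
  have l0 : 1 - l < 0 := by linarith
  have m0 : 1 - m < 0 := by linarith
  have key : ∀ {x y z w : Plane} (s t s' t' : ℝ), x = p + s • (a - p) → y = p + t • (b - p) →
      z = p + s' • (a - p) → w = p + t' • (b - p) → s ≠ 0 → t ≠ 0 → s * s' ≤ 0 → t * t' ≤ 0 →
      Disjoint (segment ℝ x y) (segment ℝ z w) := by
    rintro x y z w s t s' t' rfl rfl rfl rfl hs ht h1 h2
    exact disjoint_segment_of_axes hD hs ht h1 h2
  refine not_independent_sets_disjoint ![a, b, c, d, p]
    ![![∅, segment ℝ a b, P, segment ℝ a d, segment ℝ a p],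
      ![∅, ∅, segment ℝ c b, Q, segment ℝ b p], ![∅, ∅, ∅, segment ℝ c d, segment ℝ c p],
      ![∅, ∅, ∅, ∅, segment ℝ d p], ![∅, ∅, ∅, ∅, ∅]] (by
        intro i j hij
        fin_cases i <;> fin_cases j <;> first | exact absurd hij (by decide) | skip
        · exact seg a b
        · exact hP
        · exact seg a d
        · exact seg a p
        · exact (seg c b).symm
        · exact hQ
        · exact seg b p
        · exact seg c d
        · exact seg c p
        · exact seg d p) ?_
  refine ⟨⟨?_, ?_, ?_⟩, ⟨hPQ, hPb, hPd⟩, ⟨?_, ?_, ?_⟩, ⟨?_, hQa.symm, ?_⟩, ⟨?_, hQc, ?_⟩⟩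
  · exact key 1 1 (1 - l) (1 - m) ea eb ec ed (by simp) (by simp) (by linarith) (by linarith)
  · change Disjoint (segment ℝ a b) (segment ℝ c p)
    exact key 1 1 (1 - l) 0 ea eb ec e0' (by simp) (by simp) (by linarith) (by linarith)
  · change Disjoint (segment ℝ a b) (segment ℝ d p)
    rw [segment_symm ℝ d p]
    exact key 1 1 0 (1 - m) ea eb e0 ed (by simp) (by simp) (by linarith) (by linarith)
  · exact key 1 (1 - m) (1 - l) 1 ea ed ec eb (by simp) m0.ne (by linarith) (by linarith)
  · change Disjoint (segment ℝ a d) (segment ℝ b p)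
    rw [segment_symm ℝ b p]
    exact key 1 (1 - m) 0 1 ea ed e0 eb (by simp) m0.ne (by linarith) (by linarith)
  · change Disjoint (segment ℝ a d) (segment ℝ c p)
    exact key 1 (1 - m) (1 - l) 0 ea ed ec e0' (by simp) m0.ne (by linarith) (by linarith)
  · change Disjoint (segment ℝ a p) (segment ℝ c b)
    exact (key (1 - l) 1 1 0 ec eb ea e0' l0.ne (by simp) (by linarith) (by linarith)).symm
  · change Disjoint (segment ℝ a p) (segment ℝ c d)
    exact (key (1 - l) (1 - m) 1 0 ec ed ea e0' l0.ne m0.ne (by linarith) (by linarith)).symm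
  · change Disjoint (segment ℝ c b) (segment ℝ d p)
    rw [segment_symm ℝ d p]
    exact key (1 - l) 1 0 (1 - m) ec eb e0 ed l0.ne (by simp) (by linarith) (by linarith)
  · change Disjoint (segment ℝ b p) (segment ℝ c d)
    rw [segment_symm ℝ b p]
    exact (key (1 - l) (1 - m) 0 1 ec ed e0 eb l0.ne m0.ne (by linarith) (by linarith)).symm

/-- The ends of the heavy edges of the base graph. Its vertices are `u = 0`, `v = 1`, the two
vertices `2`, `3`, and the ends `4, …, 7` and `8, …, 11` of the light edges at `u` and `v`. -/
def heavyEnds : Fin 25 → Fin 12 × Fin 12 :=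
  ![(0, 1), (0, 2), (0, 3), (1, 2), (1, 3),
    (2, 4), (2, 8), (0, 8), (8, 4), (4, 1),
    (2, 5), (2, 9), (0, 9), (9, 5), (5, 1),
    (3, 6), (3, 10), (0, 10), (10, 6), (6, 1),
    (3, 7), (3, 11), (0, 11), (11, 7), (7, 1)]

/-- The ends of the light edges of the base graph. -/
def lightEnds : Fin 8 → Fin 12 × Fin 12 :=
  ![(0, 4), (0, 5), (0, 6), (0, 7), (1, 8), (1, 9), (1, 10), (1, 11)]

def IsHeavy (a b : Fin 12) : Prop := ∃ e, heavyEnds e = (a, b) ∨ heavyEnds e = (b, a)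

def IsLight (a b : Fin 12) : Prop := ∃ e, lightEnds e = (a, b) ∨ lightEnds e = (b, a)

instance (a b : Fin 12) : Decidable (IsHeavy a b) := inferInstanceAs (Decidable (∃ _, _))

instance (a b : Fin 12) : Decidable (IsLight a b) := inferInstanceAs (Decidable (∃ _, _))

/-- A representation of the base graph in which light edges are straight segments and any two
independent edges are disjoint unless both are light. -/
structure IsConfig (pos : Fin 12 → Plane) (S : Fin 12 → Fin 12 → Set Plane) : Prop where
  symm : ∀ a b, S a b = S b a
  joined : ∀ a b, IsHeavy a b → JoinedIn (S a b) (pos a) (pos b)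
  light : ∀ a b, IsLight a b → S a b = segment ℝ (pos a) (pos b)
  disj : ∀ a b c d, IsHeavy a b → IsHeavy c d ∨ IsLight c d → a ≠ c → a ≠ d → b ≠ c → b ≠ d →
    Disjoint (S a b) (S c d)
  avoid : ∀ a b c, IsLight a b → c ≠ a → c ≠ b → pos c ∉ S a b
  adj : ∀ a b d, IsHeavy a b → IsLight a d → b ≠ d → S a b ∩ S a d ⊆ {pos a}
  not_collinear : ∀ a b c d, IsLight a b → IsLight c d → a ≠ c → a ≠ d → b ≠ c → b ≠ d →
    (S a b ∩ S c d).Nonempty →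
    ¬ (area (pos a) (pos b) (pos c) = 0 ∧ area (pos a) (pos b) (pos d) = 0)

def endX : Fin 4 → Fin 12 := ![4, 5, 6, 7]
def endY : Fin 4 → Fin 12 := ![8, 9, 10, 11]
def endH : Fin 4 → Fin 12 := ![2, 2, 3, 3]
def partner : Fin 4 → Fin 4 := ![1, 0, 3, 2]

theorem isLight_endX : ∀ i, IsLight 0 (endX i) := by decide
theorem isLight_endY : ∀ i, IsLight 1 (endY i) := by decide
theorem isHeavy_endX_endY : ∀ i, IsHeavy (endX i) (endY i) := by decide
theorem isHeavy_endY : ∀ i, IsHeavy (endY i) 0 := by decide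
theorem isHeavy_endX : ∀ i, IsHeavy 1 (endX i) := by decide
theorem isHeavy_endH : ∀ i, IsHeavy (endH i) (endX i) := by decide
theorem endX_ne : ∀ i, endX i ≠ 0 ∧ endX i ≠ 1 ∧ endY i ≠ 0 ∧ endY i ≠ 1 := by decide
theorem endX_ne_endY : ∀ i j, endX i ≠ endY j := by decide
theorem endH_ne : ∀ i j, endH i ≠ 0 ∧ endH i ≠ 1 ∧ endH i ≠ endX j ∧ endH i ≠ endY j := by decide
theorem end_injective : ∀ i j, i ≠ j → endX i ≠ endX j ∧ endY i ≠ endY j := by decide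

namespace IsConfig

variable {pos : Fin 12 → Plane} {S : Fin 12 → Fin 12 → Set Plane}

theorem crossing_nonempty (h : IsConfig pos S) (i : Fin 4) :
    (S 0 (endX i) ∩ S 1 (endY i)).Nonempty := by
  let φ : Fin 5 → Fin 12 := ![0, 1, endH i, endX i, endY i]
  by_contra hne
  obtain ⟨a, b, c, d, hab, hcd, hac, hbc, hbd, hmeet⟩ :=
    exists_independent_sets_meet (fun a => pos (φ a)) (fun a b => S (φ a) (φ b)) (by
      intro a b hab
      have : IsHeavy (φ a) (φ b) ∨ IsLight (φ a) (φ b) := by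
        clear hne h; revert i a b; decide +kernel
      rcases this with h' | h'
      · exact h.joined _ _ h'
      · rw [h.light _ _ h']; exact JoinedIn.of_segment_subset subset_rfl)
  have key : (a = 0 ∧ b = 3 ∧ c = 1 ∧ d = 4) ∨ ((IsHeavy (φ a) (φ b) ∧ (IsHeavy (φ c) (φ d) ∨
      IsLight (φ c) (φ d)) ∨ IsLight (φ a) (φ b) ∧ IsHeavy (φ c) (φ d)) ∧
      φ a ≠ φ c ∧ φ a ≠ φ d ∧ φ b ≠ φ c ∧ φ b ≠ φ d) := by
    clear hne h hmeet; revert i a b c d; decide +kernel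
  rcases key with ⟨rfl, rfl, rfl, rfl⟩ | ⟨⟨k1, k2⟩ | ⟨k1, k2⟩, k3, k4, k5, k6⟩
  · exact hne hmeet
  · exact not_disjoint_iff_nonempty_inter.2 hmeet (h.disj _ _ _ _ k1 k2 k3 k4 k5 k6)
  · exact not_disjoint_iff_nonempty_inter.2 hmeet
      (h.disj _ _ _ _ k2 (.inr k1) k3.symm k5.symm k4.symm k6.symm).symm

theorem lightX (h : IsConfig pos S) (i : Fin 4) : S 0 (endX i) = segment ℝ (pos 0) (pos (endX i)) :=
  h.light _ _ (by revert i; decide)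

theorem lightY (h : IsConfig pos S) (i : Fin 4) : S 1 (endY i) = segment ℝ (pos 1) (pos (endY i)) :=
  h.light _ _ (by revert i; decide)

/-- A crossing of two light edges is not one of the four ends. -/
theorem ne_of_mem (h : IsConfig pos S) {i j : Fin 4} {p : Plane} (hx : p ∈ S 0 (endX i))
    (hy : p ∈ S 1 (endY j)) :
    p ≠ pos 0 ∧ p ≠ pos 1 ∧ p ≠ pos (endX i) ∧ p ≠ pos (endY j) := by
  obtain ⟨x0, x1, -, -⟩ := endX_ne i
  obtain ⟨-, -, y0, y1⟩ := endX_ne j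
  have xy := endX_ne_endY i j
  refine ⟨?_, ?_, ?_, ?_⟩ <;> rintro rfl
  · exact h.avoid _ _ _ (isLight_endY j) (by decide) y0.symm hy
  · exact h.avoid _ _ _ (isLight_endX i) (by decide) x1.symm hx
  · exact h.avoid _ _ _ (isLight_endY j) x1 xy hy
  · exact h.avoid _ _ _ (isLight_endX i) y0 xy.symm hx

theorem disjoint_light (h : IsConfig pos S) {i j : Fin 4} (hij : i ≠ j) :
    Disjoint (segment ℝ (pos 0) (pos (endX i))) (segment ℝ (pos 1) (pos (endY j))) := by
  rw [← h.lightX, ← h.lightY, disjoint_left]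
  intro p hx hy
  obtain ⟨n1, n2, n3, n4⟩ := h.ne_of_mem hx hy
  have hcol := h.not_collinear 0 (endX i) 1 (endY j) (isLight_endX i) (isLight_endY j) (by decide)
    (endX_ne j).2.2.1.symm (endX_ne i).2.1 (endX_ne_endY i j) ⟨p, hx, hy⟩
  have e1 := isHeavy_endX_endY i
  have e2 := isHeavy_endY i
  have e3 := isHeavy_endX j
  have e4 := isHeavy_endX_endY j
  have l1 := isLight_endX i
  have l2 := isLight_endY j
  have d1 := endX_ne
  have d2 := endX_ne_endY
  have d3 := end_injective i j hij
  have d4 : (1 : Fin 12) ≠ 0 := by decide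
  have P : JoinedIn (S (endX i) (endY i) ∪ S (endY i) 0) (pos 0) (pos (endX i)) :=
    (((h.joined _ _ e1).mono subset_union_left).trans
      ((h.joined _ _ e2).mono subset_union_right)).symm
  have Q : JoinedIn (S 1 (endX j) ∪ S (endX j) (endY j)) (pos 1) (pos (endY j)) :=
    ((h.joined _ _ e3).mono subset_union_left).trans
      ((h.joined _ _ e4).mono subset_union_right)
  have hx' := hx
  have hy' := hy
  rw [h.lightX] at hx'
  rw [h.lightY] at hy'
  refine not_joinedIn_of_crossing hx' hy' n1 n2 n3 n4 hcol P Q ?_ ?_ ?_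
  · simp only [disjoint_union_left, disjoint_union_right]
    refine ⟨⟨?_, ?_⟩, ?_, ?_⟩ <;> refine h.disj _ _ _ _ ‹_› (.inl ‹_›) ?_ ?_ ?_ ?_ <;>
      first | exact (d1 _).1 | exact (d1 _).1.symm | exact (d1 _).2.1 | exact (d1 _).2.2.1.symm |
        exact (d1 _).2.2.2 | exact d2 _ _ | exact (d2 _ _).symm | exact d3.1 | exact d3.2 |
        exact d4.symm
  · rw [← h.lightY, disjoint_union_left]
    refine ⟨?_, ?_⟩ <;> refine h.disj _ _ _ _ ‹_› (.inr ‹_›) ?_ ?_ ?_ ?_ <;>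
      first | exact (d1 _).1 | exact (d1 _).1.symm | exact (d1 _).2.1 | exact (d1 _).2.2.1.symm |
        exact (d1 _).2.2.2 | exact d2 _ _ | exact (d2 _ _).symm | exact d3.1 | exact d3.2 |
        exact d4.symm
  · rw [← h.lightX, disjoint_union_left]
    refine ⟨?_, ?_⟩ <;> refine h.disj _ _ _ _ ‹_› (.inr ‹_›) ?_ ?_ ?_ ?_ <;>
      first | exact d4 | exact (d1 _).1 | exact (d1 _).2.1.symm | exact (d1 _).2.2.1 |
        exact (d2 _ _).symm | exact d3.1.symm

end IsConfig

theorem JoinedIn.exists_isPreconnected {X : Type*} [TopologicalSpace X] {S : Set X} {a b : X}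
    (h : JoinedIn S a b) : ∃ C ⊆ S, IsPreconnected C ∧ a ∈ C ∧ b ∈ C := by
  refine ⟨range h.somePath, ?_, isPreconnected_range h.somePath.continuous,
    h.somePath.source_mem_range, h.somePath.target_mem_range⟩
  rintro _ ⟨t, rfl⟩
  exact h.somePath_mem t

theorem right_notMem_segment {u p x : Plane} (h : p ∈ segment ℝ u x) (hpx : p ≠ x) :
    x ∉ segment ℝ u p := by
  intro h'
  obtain ⟨s, s0, s1, rfl⟩ := mem_segment_iff_sub.1 h
  obtain ⟨t, t0, t1, ht⟩ := mem_segment_iff_sub.1 h'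
  have e : (1 - t * s) • (x - u) = 0 := by
    rw [sub_smul, one_smul, mul_smul, sub_eq_zero]
    nth_rewrite 1 [ht]
    module
  rcases smul_eq_zero.1 e with e | e
  · have : s = 1 := by nlinarith
    simp [this] at hpx
  · rw [sub_eq_zero.1 e] at hpx
    simp at hpx

theorem partner_spec : ∀ i, i ≠ partner i ∧ endH i = endH (partner i) := by decide

namespace IsConfig

variable {pos : Fin 12 → Plane} {S : Fin 12 → Fin 12 → Set Plane}

theorem area_ne_zero (h : IsConfig pos S) {i : Fin 4} {p : Plane} (hx : p ∈ S 0 (endX i))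
    (hy : p ∈ S 1 (endY i)) : area (pos 0) (pos 1) p ≠ 0 := by
  intro h0
  refine h.not_collinear 0 (endX i) 1 (endY i) (isLight_endX i) (isLight_endY i) (by decide)
    (endX_ne i).2.2.1.symm (endX_ne i).2.1 (endX_ne_endY i i) ⟨p, hx, hy⟩ ?_
  obtain ⟨n1, n2, n3, n4⟩ := h.ne_of_mem hx hy
  rw [h.lightX] at hx
  rw [h.lightY] at hy
  obtain ⟨l, -, hl⟩ := exists_of_mem_segment hx n1 n3
  obtain ⟨m, -, hm⟩ := exists_of_mem_segment hy n2 n4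
  have h1 : area (pos 0) p (pos 1) = 0 := by rw [area_swap, h0, neg_zero]
  have h2 : area (pos 0) p (pos (endY i)) = 0 := by
    rw [hm, area_add_smul_sub, h1, area_self_right]; simp
  constructor
  · rw [area_swap, hl, area_add_smul_sub, h0]; simp
  · rw [area_swap, hl, area_add_smul_sub, area_swap _ _ p, h2]; simp

theorem not_nested (h : IsConfig pos S) {p : Fin 4 → Plane} (hx : ∀ i, p i ∈ S 0 (endX i))
    (hy : ∀ i, p i ∈ S 1 (endY i)) {σ : ℝ} {i j : Fin 4} (hij : i ≠ j)
    (hi : 0 < σ * area (pos 0) (pos 1) (p i)) (hj : 0 < σ * area (pos 0) (pos 1) (p j))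
    (hp : partner j = i ∨ σ * area (pos 0) (pos 1) (p (partner j)) < 0) :
    0 ≤ σ * area (pos 0) (p i) (p j) := by
  by_contra! hnest
  have hx' : ∀ i, p i ∈ segment ℝ (pos 0) (pos (endX i)) := fun i => h.lightX i ▸ hx i
  have hy' : ∀ i, p i ∈ segment ℝ (pos 1) (pos (endY i)) := fun i => h.lightY i ▸ hy i
  have hne := fun i => h.ne_of_mem (hx i) (hy i)
  have hC : ∀ k, ∃ C ⊆ S (endH k) (endX k), IsPreconnected C ∧ pos (endH k) ∈ C ∧
      pos (endX k) ∈ C := fun k => (h.joined _ _ (isHeavy_endH k)).exists_isPreconnected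
  choose C hCS hCc hCH hCX using hC
  have subl : ∀ {x y z : Plane}, z ∈ segment ℝ x y → segment ℝ x z ⊆ segment ℝ x y :=
    fun {x y z} hz => (convex_segment x y).segment_subset (left_mem_segment ℝ x y) hz
  have D1 : ∀ k l, Disjoint (C k) (segment ℝ (pos 0) (p l)) := by
    intro k l
    by_cases hkl : k = l
    · subst hkl
      rw [disjoint_left]
      intro z hz hz'
      have := h.adj (endX k) (endH k) 0
        (by rcases isHeavy_endH k with ⟨e, he⟩; exact ⟨e, he.symm⟩)
        (by rcases isLight_endX k with ⟨e, he⟩; exact ⟨e, he.symm⟩) (endH_ne k k).1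
        ⟨h.symm _ _ ▸ hCS k hz, by rw [h.symm, h.lightX]; exact subl (hx' k) hz'⟩
      rw [mem_singleton_iff.1 this] at hz'
      exact right_notMem_segment (hx' k) (hne k).2.2.1 hz'
    · have := h.disj _ _ _ _ (isHeavy_endH k) (.inr (isLight_endX l)) (endH_ne k l).1
        (endH_ne k l).2.2.1 (endX_ne k).1 (end_injective k l hkl).1
      rw [h.lightX] at this
      exact this.mono (hCS k) (subl (hx' l))
  have D2 : ∀ k l, Disjoint (C k) (segment ℝ (pos 1) (p l)) := by
    intro k l
    have := h.disj _ _ _ _ (isHeavy_endH k) (.inr (isLight_endY l)) (endH_ne k l).2.1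
        (endH_ne k l).2.2.2 (endX_ne k).2.1 (endX_ne_endY k l)
    rw [h.lightY] at this
    exact this.mono (hCS k) (subl (hy' l))
  refine _root_.not_nested (C := C j ∪ C (partner j)) (z := pos (endX (partner j))) hi hj (hy' i)
    (hx' j) (hne j).2.2.1 (h.disjoint_light hij.symm) hnest
    ((hCc j).union (pos (endH j)) (hCH j) ((partner_spec j).2 ▸ hCH _) (hCc _))
    ((D1 _ _).union_left (D1 _ _)) ((D2 _ _).union_left (D2 _ _))
    ((D1 _ _).union_left (D1 _ _)) ((D2 _ _).union_left (D2 _ _))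
    (Or.inl (hCX j)) (Or.inr (hCX _)) ?_
  rcases hp with rfl | hp
  · exact Or.inl (area_neg_of_beyond hi (hx' _) (hne _).2.2.1)
  · right
    have := area_pos_of_beyond (σ := -σ) (by linarith) (hx' (partner j)) (hne _).2.2.1
    linarith

theorem false_of_same_side (h : IsConfig pos S) {p : Fin 4 → Plane} (hx : ∀ i, p i ∈ S 0 (endX i))
    (hy : ∀ i, p i ∈ S 1 (endY i)) {σ : ℝ} {i j : Fin 4} (hij : i ≠ j)
    (hi : 0 < σ * area (pos 0) (pos 1) (p i)) (hj : 0 < σ * area (pos 0) (pos 1) (p j))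
    (hp : partner j = i ∨ σ * area (pos 0) (pos 1) (p (partner j)) < 0)
    (hp' : partner i = j ∨ σ * area (pos 0) (pos 1) (p (partner i)) < 0) : False := by
  rcases nested_or_nested hi hj (h.lightX i ▸ hx i) (h.lightY i ▸ hy i) (h.lightX j ▸ hx j)
    (h.lightY j ▸ hy j) (h.disjoint_light hij) (h.disjoint_light hij.symm) with h' | h'
  · exact absurd h' (not_lt.2 (h.not_nested hx hy hij hi hj hp))
  · exact absurd h' (not_lt.2 (h.not_nested hx hy hij.symm hj hi hp'))

end IsConfig

theorem not_isConfig {pos : Fin 12 → Plane} {S : Fin 12 → Fin 12 → Set Plane} :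
    ¬ IsConfig pos S := by
  intro h
  choose p hx hy using h.crossing_nonempty
  have hA : ∀ i, area (pos 0) (pos 1) (p i) ≠ 0 := fun i => h.area_ne_zero (hx i) (hy i)
  have pair : ∀ i, 0 < area (pos 0) (pos 1) (p i) * area (pos 0) (pos 1) (p (partner i)) →
      False := by
    intro i hi
    have hne := (partner_spec i).1
    have hpp : partner (partner i) = i := by clear * -; revert i; decide
    exact h.false_of_same_side hx hy hne (mul_self_pos.2 (hA i)) hi (.inl hpp) (.inl rfl)
  have opp : ∀ i, area (pos 0) (pos 1) (p i) * area (pos 0) (pos 1) (p (partner i)) < 0 := fun i =>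
    lt_of_le_of_ne (not_lt.1 (pair i)) (mul_ne_zero (hA _) (hA _))
  have main : ∀ j, j ≠ 0 → 0 < area (pos 0) (pos 1) (p 0) * area (pos 0) (pos 1) (p j) → False := by
    intro j hj hs
    refine h.false_of_same_side hx hy hj.symm (mul_self_pos.2 (hA 0)) hs (.inr ?_) (.inr (opp 0))
    have h1 := opp j
    by_contra! h2
    nlinarith [mul_nonneg hs.le h2, mul_self_pos.2 (hA 0)]
  have o := opp 2
  rcases (hA 0).lt_or_gt with a | a <;> rcases (hA 2).lt_or_gt with b | b
  · exact main 2 (by decide) (mul_pos_of_neg_of_neg a b)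
  · exact main 3 (by decide) (mul_pos_of_neg_of_neg a (neg_of_mul_neg_right o b.le))
  · exact main 3 (by decide) (mul_pos a (pos_of_mul_neg_right o b.le))
  · exact main 2 (by decide) (mul_pos a b)

namespace Drawing

variable {V : Type*} {G : SimpleGraph V} (D : Drawing G)

/-- The closed arc of an edge. -/
def arcSet (e : G.edgeSet) : Set Plane := D.arc e '' Icc 0 1

theorem joinedIn_arcSet {e : G.edgeSet} {x y : V} (h : (e : Sym2 V) = s(x, y)) :
    JoinedIn (D.arcSet e) (D.vert x) (D.vert y) := by
  have hpath : IsPathConnected (D.arcSet e) :=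
    ((convex_Icc (0 : ℝ) 1).isPathConnected ⟨0, by simp⟩).image' (D.arc_cont e)
  obtain ⟨a, b, hab, h0, h1⟩ := D.arc_ends e
  have m0 : D.vert a ∈ D.arcSet e := ⟨0, by simp, h0⟩
  have m1 : D.vert b ∈ D.arcSet e := ⟨1, by simp, h1⟩
  rw [h, Sym2.eq_iff] at hab
  rcases hab with ⟨rfl, rfl⟩ | ⟨rfl, rfl⟩
  · exact hpath.joinedIn _ m0 _ m1
  · exact hpath.joinedIn _ m1 _ m0

theorem mem_of_vert_mem_arcSet {e : G.edgeSet} {v : V} (h : D.vert v ∈ D.arcSet e) :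
    v ∈ (e : Sym2 V) := by
  obtain ⟨t, ht, hv⟩ := h
  obtain ⟨a, b, hab, h0, h1⟩ := D.arc_ends e
  rw [hab, Sym2.mem_iff]
  rcases D.arc_avoid e t ht ⟨v, hv⟩ with rfl | rfl
  · exact Or.inl (D.vert_inj (hv.symm.trans h0))
  · exact Or.inr (D.vert_inj (hv.symm.trans h1))

theorem vert_or_mem_interOf {e : G.edgeSet} {z : Plane} (h : z ∈ D.arcSet e) :
    (∃ v, z = D.vert v) ∨ z ∈ D.interOf e := by
  obtain ⟨t, ht, rfl⟩ := h
  obtain ⟨a, b, hab, h0, h1⟩ := D.arc_ends e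
  rcases ht.1.eq_or_lt with rfl | h0'
  · exact Or.inl ⟨a, h0⟩
  rcases ht.2.eq_or_lt with rfl | h1'
  · exact Or.inl ⟨b, h1⟩
  · exact Or.inr ⟨t, ⟨h0', h1'⟩, rfl⟩

theorem interOf_subset_arcSet (e : G.edgeSet) : D.interOf e ⊆ D.arcSet e :=
  image_mono Ioo_subset_Icc_self

/-- Two edges meet only in common ends and in crossings. -/
theorem vert_or_mem_crossSet {e f : G.edgeSet} (hef : e ≠ f) {z : Plane} (he : z ∈ D.arcSet e)
    (hf : z ∈ D.arcSet f) :
    (∃ v, v ∈ (e : Sym2 V) ∧ v ∈ (f : Sym2 V) ∧ z = D.vert v) ∨ (z, s(e, f)) ∈ D.CrossSet := by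
  rcases D.vert_or_mem_interOf he with ⟨v, rfl⟩ | he'
  · exact Or.inl ⟨v, D.mem_of_vert_mem_arcSet he, D.mem_of_vert_mem_arcSet hf, rfl⟩
  rcases D.vert_or_mem_interOf hf with ⟨v, rfl⟩ | hf'
  · exact Or.inl ⟨v, D.mem_of_vert_mem_arcSet he, D.mem_of_vert_mem_arcSet hf, rfl⟩
  · exact Or.inr ⟨e, f, hef, rfl, he', hf'⟩

variable {D} in
theorem IsRectilinear.arcSet_eq (hD : D.IsRectilinear) {e : G.edgeSet} {x y : V}
    (h : (e : Sym2 V) = s(x, y)) : D.arcSet e = segment ℝ (D.vert x) (D.vert y) := by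
  obtain ⟨a, b, hab, h0, h1⟩ := D.arc_ends e
  have key : D.arcSet e = segment ℝ (D.vert a) (D.vert b) := by
    rw [segment_eq_image, arcSet, ← h0, ← h1]
    exact image_congr fun t ht => hD e t ht
  rw [h, Sym2.eq_iff] at hab
  rcases hab with ⟨rfl, rfl⟩ | ⟨rfl, rfl⟩
  · exact key
  · rw [key, segment_symm]

end Drawing

theorem exists_smul_eq_of_cross {w w' : Plane} (hw : w ≠ 0) (h : w.1 * w'.2 - w.2 * w'.1 = 0) :
    ∃ μ : ℝ, w' = μ • w := by
  by_cases h1 : w.1 = 0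
  · have h2 : w.2 ≠ 0 := fun h2 => hw (Prod.ext h1 h2)
    refine ⟨w'.2 / w.2, Prod.ext ?_ ?_⟩
    · simp only [Prod.smul_fst, smul_eq_mul, h1, mul_zero]
      simpa [h1, h2] using h
    · simp [h2]
  · refine ⟨w'.1 / w.1, Prod.ext (by simp [h1]) ?_⟩
    simp only [Prod.smul_snd, smul_eq_mul]
    field_simp
    linarith

/-- Collinear segments with a common point that is not an end of either overlap. -/
theorem infinite_segment_inter {a b c d z : Plane} (h1 : z ∈ segment ℝ a b)
    (h2 : z ∈ segment ℝ c d) (ha : z ≠ a) (hb : z ≠ b) (hc : z ≠ c) (hd : z ≠ d)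
    (hac : area a b c = 0) (had : area a b d = 0) :
    (segment ℝ a b ∩ segment ℝ c d).Infinite := by
  obtain ⟨s, s0, s1, hs⟩ := mem_segment_iff_sub.1 h1
  obtain ⟨t, t0, t1, ht⟩ := mem_segment_iff_sub.1 h2
  have s0' : 0 < s := lt_of_le_of_ne s0 fun h => ha (by rw [hs, ← h]; simp)
  have s1' : s < 1 := lt_of_le_of_ne s1 fun h => hb (by rw [hs, h]; simp)
  have t0' : 0 < t := lt_of_le_of_ne t0 fun h => hc (by rw [ht, ← h]; simp)
  have t1' : t < 1 := lt_of_le_of_ne t1 fun h => hd (by rw [ht, h]; simp)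
  have hw : d - c ≠ 0 := fun h => hc (by rw [ht, h]; simp)
  have hw' : b - a ≠ 0 := fun h => ha (by rw [hs, h]; simp)
  obtain ⟨μ, hμ⟩ := exists_smul_eq_of_cross (w' := b - a) hw (by
    simp only [area, Prod.fst_sub, Prod.snd_sub] at hac had ⊢
    linear_combination hac - had)
  have hU : {r : ℝ | s + r ∈ Ioo (0 : ℝ) 1 ∧ t + r * μ ∈ Ioo (0 : ℝ) 1} ∈ nhds (0 : ℝ) := by
    refine IsOpen.mem_nhds ?_ (by simp [s0', s1', t0', t1'])
    exact (isOpen_Ioo.preimage (by fun_prop : Continuous fun r : ℝ => s + r)).inter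
      (isOpen_Ioo.preimage (by fun_prop : Continuous fun r : ℝ => t + r * μ))
  refine ((infinite_of_mem_nhds _ hU).image (f := fun r : ℝ => z + r • (b - a)) ?_).mono ?_
  · intro r _ r' _ h
    exact smul_left_injective ℝ hw' (add_left_cancel h)
  · rintro _ ⟨r, ⟨hr1, hr2⟩, rfl⟩
    refine ⟨mem_segment_iff_sub.2 ⟨s + r, hr1.1.le, hr1.2.le, ?_⟩,
      mem_segment_iff_sub.2 ⟨t + r * μ, hr2.1.le, hr2.2.le, ?_⟩⟩
    · change z + r • (b - a) = _
      rw [hs, add_smul, add_assoc]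
    · simp only [hμ]
      rw [ht, add_smul, mul_smul, add_assoc]

/-- The graph with edges indexed by `E`, given by their ends. -/
def edgeGraph {V E : Type*} (ends : E → V × V) : SimpleGraph V :=
  SimpleGraph.fromEdgeSet (range fun e => s((ends e).1, (ends e).2))

theorem mem_edgeGraph {V E : Type*} {ends : E → V × V} (h : ∀ e, (ends e).1 ≠ (ends e).2)
    (e : E) : s((ends e).1, (ends e).2) ∈ (edgeGraph ends).edgeSet := by
  rw [edgeGraph, SimpleGraph.edgeSet_fromEdgeSet]
  exact ⟨⟨e, rfl⟩, by simpa using h e⟩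

theorem exists_of_mem_edgeGraph {V E : Type*} {ends : E → V × V}
    (e : (edgeGraph ends).edgeSet) : ∃ i, (e : Sym2 V) = s((ends i).1, (ends i).2) := by
  have h := e.2
  change (e : Sym2 V) ∈ (SimpleGraph.fromEdgeSet _).edgeSet at h
  rw [SimpleGraph.edgeSet_fromEdgeSet] at h
  obtain ⟨i, hi⟩ := h.1
  exact ⟨i, hi.symm⟩

abbrev BundleVert (N : ℕ) : Type := Fin 12 ⊕ Fin 25 × Fin N

abbrev BundleEdge (N : ℕ) : Type := (Fin 25 × Fin N × Bool) ⊕ Fin 8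

/-- One of the two ends of a heavy edge. -/
def heavyEnd (h : Fin 25) (b : Bool) : Fin 12 := bif b then (heavyEnds h).2 else (heavyEnds h).1

/-- The base graph with every heavy edge replaced by `N` paths of length two. -/
def bundleEnds (N : ℕ) : BundleEdge N → BundleVert N × BundleVert N
  | .inl (h, k, b) => (.inl (heavyEnd h b), .inr (h, k))
  | .inr l => (.inl (lightEnds l).1, .inl (lightEnds l).2)

theorem bundleEnds_ne (N : ℕ) (e : BundleEdge N) : (bundleEnds N e).1 ≠ (bundleEnds N e).2 := by
  rcases e with ⟨h, k, b⟩ | l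
  · simp [bundleEnds]
  · have : ∀ l, (lightEnds l).1 ≠ (lightEnds l).2 := by decide
    simpa [bundleEnds] using this l

theorem bundleEnds_injective (N : ℕ) {e e' : BundleEdge N}
    (h : s((bundleEnds N e).1, (bundleEnds N e).2) = s((bundleEnds N e').1, (bundleEnds N e').2)) :
    e = e' := by
  rcases e with ⟨i, k, b⟩ | l <;> rcases e' with ⟨i', k', b'⟩ | l'
  · have key : ∀ i b b', heavyEnd i b = heavyEnd i b' → b = b' := by decide
    simp only [bundleEnds, Sym2.eq_iff, Sum.inl.injEq, Sum.inr.injEq, Prod.mk.injEq,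
      reduceCtorEq, false_and, or_false] at h
    obtain ⟨hb, rfl, rfl⟩ := h
    rw [key _ _ _ hb]
  · simp [bundleEnds] at h
  · simp [bundleEnds] at h
  · have key : ∀ l l', ((lightEnds l).1 = (lightEnds l').1 ∧ (lightEnds l).2 = (lightEnds l').2 ∨
      (lightEnds l).1 = (lightEnds l').2 ∧ (lightEnds l).2 = (lightEnds l').1) → l = l' := by decide
    rw [key l l']
    simpa only [bundleEnds, Sym2.eq_iff, Sum.inl.injEq] using h

def bundleGraph (N : ℕ) : SimpleGraph (BundleVert N) := edgeGraph (bundleEnds N)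

def bundleEdge {N : ℕ} (e : BundleEdge N) : (bundleGraph N).edgeSet :=
  ⟨_, mem_edgeGraph (bundleEnds_ne N) e⟩

theorem bundleEdge_injective {N : ℕ} : Function.Injective (bundleEdge (N := N)) :=
  fun _ _ h => bundleEnds_injective N (congrArg Subtype.val h)

theorem Drawing.exists_uncrossed {V : Type*} {G : SimpleGraph V} (D : Drawing G) {m N : ℕ}
    (hfin : D.CrossSet.Finite) (hm : D.CrossSet.ncard < m) (hN : 4 * m ≤ N) (f : Fin N → V)
    (hf : Function.Injective f) :
    ∃ k, ∀ z (e e' : G.edgeSet), f k ∈ (e : Sym2 V) → (z, s(e, e')) ∉ D.CrossSet := by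
  by_contra! hcon
  have hx : ∀ x : D.CrossSet, ∃ g : Fin 4 → V, ∀ (e e' : G.edgeSet) (v : V), x.1.2 = s(e, e') →
      v ∈ (e : Sym2 V) → ∃ i, g i = v := by
    rintro ⟨⟨z, p⟩, -⟩
    induction p using Sym2.ind with
    | _ e₀ f₀ =>
      obtain ⟨e, he⟩ := e₀
      obtain ⟨f, hf⟩ := f₀
      induction e using Sym2.ind with
      | _ a b =>
      induction f using Sym2.ind with
      | _ c d =>
        refine ⟨![a, b, c, d], ?_⟩
        rintro e e' v h hv
        simp only [Sym2.eq_iff] at h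
        rcases h with ⟨rfl, rfl⟩ | ⟨rfl, rfl⟩ <;> rcases Sym2.mem_iff.1 hv with rfl | rfl
        · exact ⟨0, rfl⟩
        · exact ⟨1, rfl⟩
        · exact ⟨2, rfl⟩
        · exact ⟨3, rfl⟩
  choose g hg using hx
  choose z e e' hmem hcr using hcon
  have hi : ∀ k, ∃ i, g ⟨_, hcr k⟩ i = f k := fun k => hg ⟨_, hcr k⟩ _ _ _ rfl (hmem k)
  choose i hi using hi
  have : Finite D.CrossSet := hfin
  have hle := Nat.card_le_card_of_injective
    (fun k => ((⟨_, hcr k⟩ : D.CrossSet), i k)) (fun k k' h => hf (by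
      have h1 := congrArg Prod.fst h
      have h2 := congrArg Prod.snd h
      simp only at h1 h2
      rw [← hi k, ← hi k', h1, h2]))
  simp only [Nat.card_eq_fintype_card, Fintype.card_fin, Nat.card_prod] at hle
  rw [Nat.card_coe_set_eq] at hle
  omega

/-- The edge of the base graph that an edge of the bundled graph is part of. -/
def baseEdge {N : ℕ} : BundleEdge N → Sym2 (Fin 12)
  | .inl (h, _, _) => s((heavyEnds h).1, (heavyEnds h).2)
  | .inr l => s((lightEnds l).1, (lightEnds l).2)

theorem mem_baseEdge {N : ℕ} {ε : BundleEdge N} {x : Fin 12}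
    (h : (.inl x : BundleVert N) ∈ (bundleEdge ε : Sym2 (BundleVert N))) : x ∈ baseEdge ε := by
  rcases ε with ⟨i, k, b⟩ | l
  · cases b <;> simp_all [bundleEdge, bundleEnds, baseEdge, heavyEnd]
  · simpa [bundleEdge, bundleEnds, baseEdge] using h

theorem eq_of_inr_mem {N : ℕ} {ε : BundleEdge N} {p : Fin 25 × Fin N}
    (h : (.inr p : BundleVert N) ∈ (bundleEdge ε : Sym2 (BundleVert N))) :
    ∃ b, ε = .inl (p.1, p.2, b) := by
  rcases ε with ⟨i, k, b⟩ | l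
  · simp only [bundleEdge, bundleEnds, Sym2.mem_iff, reduceCtorEq, Sum.inr.injEq, false_or] at h
    exact ⟨b, by rw [h]⟩
  · simp [bundleEdge, bundleEnds] at h

theorem exists_light_eq {N : ℕ} {ε : BundleEdge N} {a b : Fin 12} (hab : IsLight a b)
    (h : baseEdge ε = s(a, b)) :
    ∃ l, ε = .inr l ∧ s((lightEnds l).1, (lightEnds l).2) = s(a, b) := by
  rcases ε with ⟨i, k, c⟩ | l
  · have key : ∀ a b, IsLight a b → ∀ i,
        ¬ ((heavyEnds i).1 = a ∧ (heavyEnds i).2 = b ∨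
          (heavyEnds i).1 = b ∧ (heavyEnds i).2 = a) := by
      decide +kernel
    exact absurd (Sym2.eq_iff.1 h) (key a b hab i)
  · exact ⟨l, rfl, h⟩

theorem exists_heavy_eq {N : ℕ} {ε : BundleEdge N} {a b : Fin 12} (hab : IsHeavy a b)
    (h : baseEdge ε = s(a, b)) : ∃ i k c, ε = .inl (i, k, c) := by
  rcases ε with ⟨i, k, c⟩ | l
  · exact ⟨i, k, c, rfl⟩
  · have key : ∀ a b, IsHeavy a b → ∀ i,
        ¬ ((lightEnds i).1 = a ∧ (lightEnds i).2 = b ∨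
          (lightEnds i).1 = b ∧ (lightEnds i).2 = a) := by
      decide +kernel
    exact absurd (Sym2.eq_iff.1 h) (key a b hab l)

/-- The part of the bundled graph selected by a choice of one path from every bundle. -/
def selected {N : ℕ} (κ : Fin 25 → Fin N) : BundleEdge N → Prop
  | .inl (h, k, _) => k = κ h
  | .inr _ => True

namespace Drawing

variable {N : ℕ} (D : Drawing (bundleGraph N)) (κ : Fin 25 → Fin N)

/-- The union of the selected arcs between two vertices of the base graph. -/
def bundleSet (a b : Fin 12) : Set Plane :=
  {z | ∃ ε, selected κ ε ∧ baseEdge ε = s(a, b) ∧ z ∈ D.arcSet (bundleEdge ε)}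

variable {D κ}

theorem common_of_mem_bundleSet
    (hκ : ∀ h z (e e' : (bundleGraph N).edgeSet),
      (.inr (h, κ h) : BundleVert N) ∈ (e : Sym2 (BundleVert N)) → (z, s(e, e')) ∉ D.CrossSet)
    {a b c d : Fin 12} (hab : IsHeavy a b)
    (hne : s(a, b) ≠ s(c, d)) {z : Plane} (h1 : z ∈ D.bundleSet κ a b)
    (h2 : z ∈ D.bundleSet κ c d) : ∃ x, x ∈ s(a, b) ∧ x ∈ s(c, d) ∧ z = D.vert (.inl x) := by
  obtain ⟨ε, hs, hb, hz⟩ := h1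
  obtain ⟨ε', hs', hb', hz'⟩ := h2
  obtain ⟨i, k, t, rfl⟩ := exists_heavy_eq hab hb
  have hε : (Sum.inl (i, k, t) : BundleEdge N) ≠ ε' := fun h => hne (by rw [← hb, ← hb', h])
  rcases D.vert_or_mem_crossSet (bundleEdge_injective.ne hε) hz hz' with ⟨v, hv, hv', rfl⟩ | hcr
  · rcases v with x | p
    · exact ⟨x, hb ▸ mem_baseEdge hv, hb' ▸ mem_baseEdge hv', rfl⟩
    · obtain ⟨_, h⟩ := eq_of_inr_mem hv
      obtain ⟨_, h'⟩ := eq_of_inr_mem hv'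
      rw [h] at hb
      rw [h'] at hb'
      exact absurd (hb.symm.trans hb') hne
  · refine absurd hcr (hκ i _ _ _ ?_)
    cases (hs : k = κ i)
    simp [bundleEdge, bundleEnds]

theorem bundleSet_eq_of_isLight {a b : Fin 12} (hab : IsLight a b) :
    ∃ l : Fin 8, s((lightEnds l).1, (lightEnds l).2) = s(a, b) ∧
      D.bundleSet κ a b = D.arcSet (bundleEdge (.inr l)) := by
  obtain ⟨l, hl⟩ := hab
  have hl' : s((lightEnds l).1, (lightEnds l).2) = s(a, b) := by
    rcases hl with hl | hl <;> simp [hl]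
  refine ⟨l, hl', ?_⟩
  ext z
  constructor
  · rintro ⟨ε, -, hb, hz⟩
    obtain ⟨l', rfl, h'⟩ := exists_light_eq ⟨l, hl⟩ hb
    have : (Sum.inr l' : BundleEdge N) = .inr l := by
      apply bundleEnds_injective
      have := h'.trans hl'.symm
      simpa only [bundleEnds, Sym2.eq_iff, Sum.inl.injEq] using this
    rwa [← this]
  · exact fun hz => ⟨.inr l, trivial, hl', hz⟩

theorem isConfig_of_uncrossed (hD : D.IsRectilinear) (hfin : D.CrossSet.Finite)
    (hκ : ∀ h z (e e' : (bundleGraph N).edgeSet),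
      (.inr (h, κ h) : BundleVert N) ∈ (e : Sym2 (BundleVert N)) → (z, s(e, e')) ∉ D.CrossSet) :
    IsConfig (fun a => D.vert (.inl a)) (D.bundleSet κ) := by
  have inj : ∀ a b, D.vert (.inl a) = D.vert (.inl b) → a = b := fun a b h =>
    Sum.inl_injective (D.vert_inj h)
  have edge_eq : ∀ {l : Fin 8} {a b : Fin 12}, s((lightEnds l).1, (lightEnds l).2) = s(a, b) →
      (bundleEdge (N := N) (.inr l)).1 = s(.inl a, .inl b) := fun {l a b} hl => by
    change Sym2.map Sum.inl s((lightEnds l).1, (lightEnds l).2) = _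
    rw [hl]; rfl
  refine ⟨fun a b => ?_, fun a b hab => ?_, fun a b hab => ?_,
    fun a b c d hab hcd n1 n2 n3 n4 => ?_, fun a b c hab n1 n2 => ?_, fun a b d hab had n => ?_, ?_⟩
  · simp only [bundleSet, Sym2.eq_swap (a := a)]
  · have key : ∀ i, JoinedIn (D.bundleSet κ (heavyEnds i).1 (heavyEnds i).2)
        (D.vert (.inl (heavyEnds i).1)) (D.vert (.inl (heavyEnds i).2)) := by
      intro i
      have half : ∀ b, JoinedIn (D.bundleSet κ (heavyEnds i).1 (heavyEnds i).2)
          (D.vert (.inl (heavyEnd i b))) (D.vert (.inr (i, κ i))) := fun b =>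
        (D.joinedIn_arcSet (e := bundleEdge (.inl (i, κ i, b))) rfl).mono fun z hz =>
          ⟨.inl (i, κ i, b), rfl, rfl, hz⟩
      exact (half false).trans (half true).symm
    obtain ⟨i, hi | hi⟩ := hab
    · simpa only [hi] using key i
    · have := (key i).symm
      simp only [hi] at this
      simpa only [bundleSet, Sym2.eq_swap (a := a)] using this
  · obtain ⟨l, hl, h⟩ := bundleSet_eq_of_isLight (D := D) (κ := κ) hab
    rw [h, hD.arcSet_eq (edge_eq hl)]
  · rw [disjoint_left]
    intro z h1 h2
    obtain ⟨x, hx, hx', -⟩ := common_of_mem_bundleSet hκ hab (by simp [n1, n2]) h1 h2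
    rw [Sym2.mem_iff] at hx hx'
    rcases hx with rfl | rfl <;> tauto
  · obtain ⟨l, hl, h⟩ := bundleSet_eq_of_isLight (D := D) (κ := κ) hab
    rw [h]
    intro hc
    have := D.mem_of_vert_mem_arcSet hc
    rw [edge_eq hl] at this
    simp_all
  · rintro z ⟨h1, h2⟩
    obtain ⟨x, hx, hx', rfl⟩ := common_of_mem_bundleSet hκ hab (by
      intro h
      rw [Sym2.eq_iff] at h
      rcases h with h | h
      · exact n h.2
      · exact n (h.2.trans h.1)) h1 h2
    rw [Sym2.mem_iff] at hx hx'
    rcases hx with rfl | rfl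
    · rfl
    · rcases hx' with rfl | rfl
      · rfl
      · exact absurd rfl n
  · rintro a b c d hab hcd n1 n2 n3 n4 ⟨z, h1, h2⟩ ⟨c1, c2⟩
    obtain ⟨l, hl, h⟩ := bundleSet_eq_of_isLight (D := D) (κ := κ) hab
    obtain ⟨l', hl', h'⟩ := bundleSet_eq_of_isLight (D := D) (κ := κ) hcd
    rw [h] at h1
    rw [h'] at h2
    have hne : bundleEdge (.inr l : BundleEdge N) ≠ bundleEdge (.inr l') := by
      intro he
      have := congrArg Subtype.val he
      rw [edge_eq hl, edge_eq hl'] at this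
      simp [n1, n2] at this
    have cross : ∀ y ∈ D.arcSet (bundleEdge (.inr l)) ∩ D.arcSet (bundleEdge (.inr l')),
        (y, s(bundleEdge (.inr l : BundleEdge N), bundleEdge (.inr l'))) ∈ D.CrossSet := by
      rintro y ⟨hy, hy'⟩
      rcases D.vert_or_mem_crossSet hne hy hy' with ⟨v, hv, hv', -⟩ | hcr
      · rw [edge_eq hl, Sym2.mem_iff] at hv
        rw [edge_eq hl', Sym2.mem_iff] at hv'
        rcases hv with rfl | rfl <;> simp_all
      · exact hcr
    have novert : ∀ v, z ≠ D.vert v := by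
      rintro v rfl
      have hv := D.mem_of_vert_mem_arcSet h1
      have hv' := D.mem_of_vert_mem_arcSet h2
      rw [edge_eq hl, Sym2.mem_iff] at hv
      rw [edge_eq hl', Sym2.mem_iff] at hv'
      rcases hv with rfl | rfl <;> simp_all
    have e1 := hD.arcSet_eq (edge_eq hl)
    have e2 := hD.arcSet_eq (edge_eq hl')
    have hinf := infinite_segment_inter (e1 ▸ h1) (e2 ▸ h2) (novert _) (novert _) (novert _)
      (novert _) c1 c2
    rw [← e1, ← e2] at hinf
    have himg := hinf.image (f := fun y => (y, s(bundleEdge (.inr l : BundleEdge N),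
      bundleEdge (.inr l')))) fun _ _ _ _ h => congrArg Prod.fst h
    exact himg (hfin.subset (by rintro _ ⟨y, hy, rfl⟩; exact cross y hy))

end Drawing

/-- Rectilinear drawings of the bundled graph have many crossings. -/
theorem le_ncard_crossSet_bundleGraph {m N : ℕ} (hN : 4 * m ≤ N) (D : Drawing (bundleGraph N))
    (hD : D.IsRectilinear) (hfin : D.CrossSet.Finite) : m ≤ D.CrossSet.ncard := by
  by_contra! hm
  choose κ hκ using fun h : Fin 25 => D.exists_uncrossed hfin hm hN (fun k => .inr (h, k))
    fun k k' hk => by simpa using hk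
  exact not_isConfig (D.isConfig_of_uncrossed hD hfin hκ)

namespace Drawing

variable {V : Type*} {G : SimpleGraph V}

/-- A drawing given by arcs that contain no vertices other than the ends of their edges. -/
def ofArcs (vert : V → Plane) (hvert : Function.Injective vert) (arc : G.edgeSet → ℝ → Plane)
    (hcont : ∀ e, ContinuousOn (arc e) (Icc 0 1)) (hinj : ∀ e, InjOn (arc e) (Icc 0 1))
    (hends : ∀ e : G.edgeSet, ∃ x y : V,
      (e : Sym2 V) = s(x, y) ∧ arc e 0 = vert x ∧ arc e 1 = vert y)
    (havoid : ∀ (e : G.edgeSet) (v : V), vert v ∈ arc e '' Icc 0 1 → v ∈ (e : Sym2 V)) :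
    Drawing G where
  vert := vert
  vert_inj := hvert
  arc := arc
  arc_cont := hcont
  arc_injOn := hinj
  arc_ends := hends
  arc_avoid := by
    rintro e t ht ⟨v, hv⟩
    obtain ⟨x, y, hxy, h0, h1⟩ := hends e
    have hmem := havoid e v ⟨t, ht, hv⟩
    rw [hxy, Sym2.mem_iff] at hmem
    rcases hmem with rfl | rfl
    · exact Or.inl (hinj e ht (by simp) (hv.trans h0.symm))
    · exact Or.inr (hinj e ht (by simp) (hv.trans h1.symm))

theorem injective_lineMap_of_ne {a b : Plane} (h : a ≠ b) :
    Function.Injective fun t : ℝ => (1 - t) • a + t • b := by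
  intro s t hst
  have : (s - t) • (b - a) = 0 := by
    have hst' : (1 - s) • a + s • b - ((1 - t) • a + t • b) = 0 := sub_eq_zero.2 hst
    rw [← hst']
    module
  rcases smul_eq_zero.1 this with h' | h'
  · exact sub_eq_zero.1 h'
  · exact absurd (sub_eq_zero.1 h').symm h

/-- Straight-line drawings exist for any position of the vertices in which no vertex lies on an
edge it is not an end of. -/
theorem exists_isRectilinear (vert : V → Plane) (hvert : Function.Injective vert)
    (havoid : ∀ x y v, G.Adj x y → v ≠ x → v ≠ y → vert v ∉ segment ℝ (vert x) (vert y)) :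
    ∃ D : Drawing G, D.vert = vert ∧ D.IsRectilinear := by
  have hp : ∀ e : G.edgeSet, ∃ p : V × V, (e : Sym2 V) = s(p.1, p.2) ∧ G.Adj p.1 p.2 := by
    rintro ⟨e, he⟩
    induction e using Sym2.ind with
    | _ x y => exact ⟨(x, y), rfl, he⟩
  choose p hp hadj using hp
  refine ⟨ofArcs vert hvert (fun e t => (1 - t) • vert (p e).1 + t • vert (p e).2)
    (fun e => by fun_prop)
    (fun e => (injective_lineMap_of_ne (hvert.ne (hadj e).ne)).injOn)
    (fun e => ⟨_, _, hp e, by simp, by simp⟩) ?_, rfl, ?_⟩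
  · intro e v hv
    rw [← segment_eq_image] at hv
    by_contra hcon
    rw [hp e, Sym2.mem_iff, not_or] at hcon
    exact havoid _ _ v (hadj e) hcon.1 hcon.2 hv
  · intro e t _
    simp [ofArcs]

end Drawing

/-- Every finite graph has a rectilinear drawing with finitely many crossings. -/
theorem exists_isRectilinear_finite {n : ℕ} (G : SimpleGraph (Fin n)) :
    ∃ D : Drawing G, D.IsRectilinear ∧ D.CrossSet.Finite := by
  have onchord : ∀ {x y : Fin n} {z : Plane},
      z ∈ segment ℝ ((x : ℝ), (x : ℝ) ^ 2) ((y : ℝ), (y : ℝ) ^ 2) →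
      z.2 = ((x : ℝ) + y) * z.1 - x * y := by
    rintro x y z ⟨s, t, -, -, hst, rfl⟩
    simp only [Prod.smul_mk, smul_eq_mul, Prod.mk_add_mk]
    obtain rfl : s = 1 - t := by linarith
    ring
  obtain ⟨D, hv, hD⟩ := Drawing.exists_isRectilinear (G := G)
    (fun i : Fin n => ((i : ℝ), (i : ℝ) ^ 2)) (fun i j h => by
      have := congrArg Prod.fst h
      simpa [Fin.ext_iff] using this) (by
      intro x y v _ hx hy hmem
      have := onchord hmem
      simp only at this
      have h0 : ((v : ℝ) - x) * ((v : ℝ) - y) = 0 := by linear_combination this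
      rcases mul_eq_zero.1 h0 with h | h
      · exact hx (Fin.ext (by exact_mod_cast sub_eq_zero.1 h))
      · exact hy (Fin.ext (by exact_mod_cast sub_eq_zero.1 h)))
  refine ⟨D, hD, ?_⟩
  refine Set.Finite.of_injOn (f := Prod.snd) (t := univ) (fun _ _ => mem_univ _) ?_ finite_univ
  rintro ⟨z, p⟩ ⟨e, f, hef, hp, hz1, hz2⟩ ⟨z', p'⟩ ⟨e', f', hef', hp', hz1', hz2'⟩ (rfl : p = p')
  simp only at hp hp' hz1 hz2 hz1' hz2'
  have hz : z' ∈ D.interOf e ∧ z' ∈ D.interOf f := by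
    rw [hp, Sym2.eq_iff] at hp'
    rcases hp' with ⟨rfl, rfl⟩ | ⟨rfl, rfl⟩
    · exact ⟨hz1', hz2'⟩
    · exact ⟨hz2', hz1'⟩
  have line : ∀ e : G.edgeSet, ∃ x y : Fin n, (e : Sym2 (Fin n)) = s(x, y) ∧
      ∀ z ∈ D.interOf e, z.2 = ((x : ℝ) + y) * z.1 - x * y := by
    intro e
    obtain ⟨x, y, hxy, -, -⟩ := D.arc_ends e
    refine ⟨x, y, hxy, fun z hz => onchord ?_⟩
    have := D.interOf_subset_arcSet e hz
    rwa [hD.arcSet_eq hxy, hv] at this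
  obtain ⟨a, b, hab, l1⟩ := line e
  obtain ⟨c, d, hcd, l2⟩ := line f
  have e1 := l1 z hz1
  have e2 := l2 z hz2
  have e3 := l1 z' hz.1
  have e4 := l2 z' hz.2
  by_cases hs : (a : ℝ) + b = c + d
  · have hpr : (a : ℝ) * b = c * d := by linear_combination e1 - e2 + z.1 * hs
    have h0 : ((a : ℝ) - c) * (a - d) = 0 := by linear_combination a * hs - hpr
    refine absurd (Subtype.ext ?_) hef
    rw [hab, hcd, Sym2.eq_iff]
    rcases mul_eq_zero.1 h0 with h | h
    · left
      exact ⟨Fin.ext (by exact_mod_cast sub_eq_zero.1 h),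
        Fin.ext (by exact_mod_cast (by linarith : (b : ℝ) = d))⟩
    · right
      exact ⟨Fin.ext (by exact_mod_cast sub_eq_zero.1 h),
        Fin.ext (by exact_mod_cast (by linarith : (b : ℝ) = c))⟩
  · have h0 : ((a : ℝ) + b - (c + d)) * (z.1 - z'.1) = 0 := by
      linear_combination -e1 + e2 + e3 - e4
    have h1 : z.1 = z'.1 := by
      rcases mul_eq_zero.1 h0 with h | h
      · exact absurd (sub_eq_zero.1 h) hs
      · exact sub_eq_zero.1 h
    have h2 : z.2 = z'.2 := by rw [e1, e3, h1]
    exact Prod.ext (Prod.ext h1 h2) rfl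

/-- A point with integer coordinates. -/
def toPlane (p : ℤ × ℤ) : Plane := (p.1, p.2)

theorem toPlane_injective : Function.Injective toPlane := fun p q h => by
  have h1 := congrArg Prod.fst h
  have h2 := congrArg Prod.snd h
  simp only [toPlane, Int.cast_inj] at h1 h2
  exact Prod.ext h1 h2

def dot (l p : ℤ × ℤ) : ℤ := l.1 * p.1 + l.2 * p.2

/-- The triangle spanned by three integer points. -/
def triangle (A : Fin 3 → ℤ × ℤ) : Set Plane :=
  {z | ∃ c : Fin 3 → ℝ, (∀ i, 0 ≤ c i) ∧ ∑ i, c i = 1 ∧ z = ∑ i, c i • toPlane (A i)}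

/-- The functional `l` separates two triangles except for common corners. -/
def SepBy (A B : Fin 3 → ℤ × ℤ) (l : ℤ × ℤ) : Prop := ∀ i j, dot l (A i) < dot l (B j) ∨ A i = B j

instance (A B : Fin 3 → ℤ × ℤ) (l : ℤ × ℤ) : Decidable (SepBy A B l) :=
  inferInstanceAs (Decidable (∀ _, _))

theorem SepBy.exists_eq {A B : Fin 3 → ℤ × ℤ} {l : ℤ × ℤ} (h : SepBy A B l) {z : Plane}
    (hA : z ∈ triangle A) (hB : z ∈ triangle B) : ∃ i j, A i = B j ∧ z = toPlane (A i) := by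
  obtain ⟨c, hc, c1, hz⟩ := hA
  obtain ⟨d, hd, d1, hz'⟩ := hB
  have hLA : (l.1 : ℝ) * z.1 + l.2 * z.2 = ∑ i, c i * dot l (A i) := by
    simp only [hz, Prod.fst_sum, Prod.snd_sum, Finset.mul_sum, ← Finset.sum_add_distrib]
    refine Finset.sum_congr rfl fun i _ => ?_
    simp only [toPlane, dot, Prod.smul_mk, smul_eq_mul]
    push_cast
    ring
  have hLB : (l.1 : ℝ) * z.1 + l.2 * z.2 = ∑ j, d j * dot l (B j) := by
    simp only [hz', Prod.fst_sum, Prod.snd_sum, Finset.mul_sum, ← Finset.sum_add_distrib]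
    refine Finset.sum_congr rfl fun i _ => ?_
    simp only [toPlane, dot, Prod.smul_mk, smul_eq_mul]
    push_cast
    ring
  have hle : ∀ i j, (0 : ℝ) ≤ dot l (B j) - dot l (A i) := by
    intro i j
    have : dot l (A i) ≤ dot l (B j) := by
      rcases h i j with h | h
      · exact h.le
      · rw [h]
    exact sub_nonneg.2 (by exact_mod_cast this)
  have hsum : ∑ i, ∑ j, c i * d j * ((dot l (B j) : ℝ) - dot l (A i)) = 0 := by
    have h1 : ∑ i, ∑ j, c i * d j * (dot l (B j) : ℝ) = ∑ j, d j * dot l (B j) := by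
      simp_rw [mul_assoc, ← Finset.mul_sum]
      rw [← Finset.sum_mul, c1, one_mul]
    have h2 : ∑ i, ∑ j, c i * d j * (dot l (A i) : ℝ) = ∑ i, c i * dot l (A i) := by
      refine Finset.sum_congr rfl fun i _ => ?_
      simp_rw [mul_right_comm _ _ (dot l (A i) : ℝ)]
      rw [← Finset.mul_sum, d1, mul_one]
    simp_rw [mul_sub, Finset.sum_sub_distrib]
    rw [h1, h2, ← hLA, ← hLB, sub_self]
  have heq : ∀ i j, 0 < c i → 0 < d j → A i = B j := by
    intro i j hi hj
    have h0 := (Finset.sum_eq_zero_iff_of_nonneg fun i _ => Finset.sum_nonneg fun j _ =>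
      mul_nonneg (mul_nonneg (hc i) (hd j)) (hle i j)).1 hsum i (Finset.mem_univ _)
    have h1 := (Finset.sum_eq_zero_iff_of_nonneg fun j _ =>
      mul_nonneg (mul_nonneg (hc i) (hd j)) (hle i j)).1 h0 j (Finset.mem_univ _)
    have h2 : (dot l (A i) : ℝ) = dot l (B j) := by
      rcases mul_eq_zero.1 h1 with h | h
      · exact absurd h (mul_pos hi hj).ne'
      · linarith
    rcases h i j with h3 | h3
    · exact absurd (Int.cast_injective h2) h3.ne
    · exact h3
  have pos : ∀ c : Fin 3 → ℝ, (∀ i, 0 ≤ c i) → ∑ i, c i = 1 → ∃ i, 0 < c i := by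
    intro c hc c1
    by_contra! hcon
    have := Finset.sum_nonpos fun i (_ : i ∈ Finset.univ) => hcon i
    linarith
  obtain ⟨i, hi⟩ := pos c hc c1
  obtain ⟨j, hj⟩ := pos d hd d1
  refine ⟨i, j, heq i j hi hj, ?_⟩
  have : ∀ j, d j • toPlane (B j) = d j • toPlane (A i) := by
    intro j
    rcases (hd j).eq_or_lt with h | h
    · simp [← h]
    · rw [heq i j hi h]
  rw [hz', Finset.sum_congr rfl fun j _ => this j, ← Finset.sum_smul, d1, one_smul]

/-- Two triangles are separated by a functional from a fixed list. -/
def IsSep (A B : Fin 3 → ℤ × ℤ) : Prop :=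
  ∃ l ∈ ([(-1, -8), (-8, 5), (-7, -8), (-3, 7), (-1, 7), (-7, 8), (-3, -8), (-8, -5), (-1, -6),
    (-1, 4)] : List (ℤ × ℤ)), SepBy A B l ∨ SepBy B A l

instance (A B : Fin 3 → ℤ × ℤ) : Decidable (IsSep A B) :=
  inferInstanceAs (Decidable (∃ l ∈ _, _))

theorem IsSep.exists_eq {A B : Fin 3 → ℤ × ℤ} (h : IsSep A B) {z : Plane}
    (hA : z ∈ triangle A) (hB : z ∈ triangle B) : ∃ i j, A i = B j ∧ z = toPlane (A i) := by
  obtain ⟨l, -, h | h⟩ := h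
  · exact h.exists_eq hA hB
  · obtain ⟨i, j, hij, hz⟩ := h.exists_eq hB hA
    exact ⟨j, i, hij.symm, hij ▸ hz⟩

/-- The positions of the vertices of the base graph. -/
def base : Fin 12 → ℤ × ℤ :=
  ![(-200, 0), (200, 0), (0, 100), (0, -100), (60, 40), (60, 180), (60, -40), (60, -180),
    (-60, 40), (-60, 180), (-60, -40), (-60, -180)]

/-- The apexes of the triangles that contain the bundles. -/
def apex : Fin 25 → ℤ × ℤ :=
  ![(0, 2), (-100, 52), (-100, -48), (100, 52), (100, -48), (32, 70), (-28, 70), (-130, 22),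
    (0, 42), (130, 22), (32, 140), (-28, 140), (-128, 90), (0, 182), (132, 90), (32, -70),
    (-28, -70), (-130, -18), (0, -38), (130, -18), (32, -140), (-28, -140), (-128, -90), (0, -178),
    (132, -90)]

/-- The points at which the light edges bend. -/
def bend : Fin 8 → ℤ × ℤ :=
  ![(-70, 20), (-120, 240), (-70, -20), (-120, -240), (70, 20), (120, 240), (70, -20), (120, -240)]

/-- The triangle that contains a bundle. -/
def heavyTriangle (h : Fin 25) : Fin 3 → ℤ × ℤ :=
  ![base (heavyEnds h).1, base (heavyEnds h).2, apex h]

/-- The two straight pieces of a light edge, as degenerate triangles. -/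
def lightPiece (l : Fin 8) (b : Bool) : Fin 3 → ℤ × ℤ :=
  ![base (bif b then (lightEnds l).2 else (lightEnds l).1), bend l, bend l]

theorem sep_heavy_heavy : ∀ h h', h ≠ h' → IsSep (heavyTriangle h) (heavyTriangle h') := by
  decide +kernel

theorem sep_heavy_light : ∀ h l b, IsSep (heavyTriangle h) (lightPiece l b) := by
  decide +kernel

theorem sep_heavy_base : ∀ h x, IsSep (heavyTriangle h) fun _ => base x := by
  decide +kernel

theorem sep_light_base : ∀ l b x, IsSep (lightPiece l b) fun _ => base x := by
  decide +kernel

theorem sep_light : ∀ l, IsSep (lightPiece l false) (lightPiece l true) := by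
  decide +kernel

theorem sep_light_light : ∀ l l' b b', l ≠ l' →
    l' = l + 4 ∧ b = true ∧ b' = true ∨ IsSep (lightPiece l b) (lightPiece l' b') := by
  decide +kernel

theorem heavy_heavy_corner : ∀ h h' i j, h ≠ h' → heavyTriangle h i = heavyTriangle h' j →
    ∃ x, heavyTriangle h i = base x := by
  decide +kernel

theorem heavy_light_corner : ∀ h l b i j, heavyTriangle h i = lightPiece l b j →
    ∃ x, heavyTriangle h i = base x := by
  decide +kernel

theorem light_light_corner : ∀ l l' b b' i j, l ≠ l' → lightPiece l b i = lightPiece l' b' j →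
    ∃ x, lightPiece l b i = base x := by
  decide +kernel

theorem light_corner : ∀ l i j, lightPiece l false i = lightPiece l true j →
    lightPiece l false i = bend l := by
  decide +kernel

theorem heavy_base_corner : ∀ h x i, heavyTriangle h i = base x →
    x = (heavyEnds h).1 ∨ x = (heavyEnds h).2 := by
  decide +kernel

theorem light_base_corner : ∀ l b x i, lightPiece l b i = base x →
    x = (lightEnds l).1 ∨ x = (lightEnds l).2 := by
  decide +kernel

theorem base_injective : Function.Injective base := by
  have : ∀ x y, base x = base y → x = y := by decide +kernel
  exact this

/-- Twice the signed area of a triangle. -/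
def det (p q r : ℤ × ℤ) : ℤ := (q.1 - p.1) * (r.2 - p.2) - (q.2 - p.2) * (r.1 - p.1)

theorem det_heavyTriangle :
    ∀ h, det (base (heavyEnds h).1) (base (heavyEnds h).2) (apex h) ≠ 0 := by
  decide +kernel

theorem base_ne_bend : ∀ x l, base x ≠ bend l := by
  decide +kernel

/-- The directions of the second pieces of two light edges that cross. -/
theorem cross_light : ∀ l : Fin 8,
    ((base (lightEnds l).2).1 - (bend l).1) *
        ((base (lightEnds (l + 4)).2).2 - (bend (l + 4)).2) -
      ((base (lightEnds l).2).2 - (bend l).2) *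
        ((base (lightEnds (l + 4)).2).1 - (bend (l + 4)).1) ≠ 0 := by
  decide +kernel

/-- The point with given affine coordinates relative to the triangle of a heavy edge: the
midpoint of the edge is the origin, the ends of the edge are `(-1, 0)` and `(1, 0)`, and the apex
is `(0, 1)`. -/
def heavyPoint (h : Fin 25) (g f : ℝ) : Plane :=
  ((1 - f - g) / 2) • toPlane (base (heavyEnds h).1) +
    ((1 - f + g) / 2) • toPlane (base (heavyEnds h).2) + f • toPlane (apex h)

theorem heavyPoint_inj {h : Fin 25} {g f g' f' : ℝ} (heq : heavyPoint h g f = heavyPoint h g' f') :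
    g = g' ∧ f = f' := by
  have hdet : (det (base (heavyEnds h).1) (base (heavyEnds h).2) (apex h) : ℝ) ≠ 0 := by
    exact_mod_cast det_heavyTriangle h
  have h1 := congrArg Prod.fst heq
  have h2 := congrArg Prod.snd heq
  simp only [heavyPoint, toPlane, Prod.smul_mk, smul_eq_mul, Prod.mk_add_mk] at h1 h2
  simp only [det] at hdet
  push_cast at hdet
  generalize ((base (heavyEnds h).1).1 : ℝ) = a1 at *
  generalize ((base (heavyEnds h).1).2 : ℝ) = a2 at *
  generalize ((base (heavyEnds h).2).1 : ℝ) = b1 at *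
  generalize ((base (heavyEnds h).2).2 : ℝ) = b2 at *
  generalize ((apex h).1 : ℝ) = m1 at *
  generalize ((apex h).2 : ℝ) = m2 at *
  constructor
  · refine sub_eq_zero.1 ((mul_eq_zero.1 ?_).resolve_right hdet)
    linear_combination (2 * m2 - a2 - b2) * h1 - (2 * m1 - a1 - b1) * h2
  · refine sub_eq_zero.1 ((mul_eq_zero.1 ?_).resolve_right hdet)
    linear_combination (-(b2 - a2)) * h1 + (b1 - a1) * h2

theorem heavyPoint_mem_triangle {h : Fin 25} {g f : ℝ} (hf : 0 ≤ f) (hg : |g| ≤ 1 - f) :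
    heavyPoint h g f ∈ triangle (heavyTriangle h) := by
  have := abs_le.1 hg
  refine ⟨![(1 - f - g) / 2, (1 - f + g) / 2, f], ?_, ?_, ?_⟩
  · intro i
    fin_cases i
    · simp; linarith
    · simp; linarith
    · simpa
  · simp [Fin.sum_univ_three]; ring
  · simp [Fin.sum_univ_three, heavyPoint, heavyTriangle]

/-- The first coordinate of an end of a heavy edge. -/
def endSign (b : Bool) : ℝ := bif b then 1 else -1

theorem endSign_mul_self (b : Bool) : endSign b * endSign b = 1 := by cases b <;> simp [endSign]

theorem abs_endSign (b : Bool) : |endSign b| = 1 := by cases b <;> simp [endSign]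

theorem endSign_eq {b b' : Bool} (h : b ≠ b') : endSign b = -endSign b' := by
  cases b <;> cases b' <;> simp_all [endSign]

theorem heavyPoint_endSign (h : Fin 25) (b : Bool) :
    heavyPoint h (endSign b) 0 = toPlane (base (heavyEnd h b)) := by
  cases b <;> simp [heavyPoint, endSign, heavyEnd]

/-- The height of a path in its bundle. -/
def height {N : ℕ} (k : Fin N) : ℝ := ((k : ℝ) + 1) / (N + 1)

theorem height_pos {N : ℕ} (k : Fin N) : 0 < height k := by unfold height; positivity

theorem height_lt_one {N : ℕ} (k : Fin N) : height k < 1 := by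
  have : (k : ℝ) < N := by exact_mod_cast k.2
  rw [height, div_lt_one (by positivity)]
  linarith

theorem height_injective {N : ℕ} : Function.Injective (height (N := N)) := by
  intro k k' h
  rw [height, height, div_left_inj' (by positivity), add_left_inj] at h
  exact Fin.ext (by exact_mod_cast h)

/-- The positions of the vertices of the bundled graph. -/
def bundlePos {N : ℕ} : BundleVert N → Plane
  | .inl x => toPlane (base x)
  | .inr (h, k) => heavyPoint h 0 (height k)

/-- The polygonal arc of a light edge. -/
def lightArc (l : Fin 8) (t : ℝ) : Plane :=
  if t ≤ 1 / 2 then (1 - 2 * t) • toPlane (base (lightEnds l).1) + (2 * t) • toPlane (bend l)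
  else (1 - (2 - 2 * t)) • toPlane (base (lightEnds l).2) + (2 - 2 * t) • toPlane (bend l)

/-- The arcs of the edges of the bundled graph. -/
def bundleArc {N : ℕ} : BundleEdge N → ℝ → Plane
  | .inl (h, k, b) => fun t => heavyPoint h (endSign b * (1 - t)) (t * height k)
  | .inr l => lightArc l

theorem toPlane_mem_triangle (p : ℤ × ℤ) : toPlane p ∈ triangle fun _ => p :=
  ⟨![1, 0, 0], by intro i; fin_cases i <;> simp, by simp [Fin.sum_univ_three],
    by simp [Fin.sum_univ_three]⟩

theorem lightPiece_combo_mem {l : Fin 8} {b : Bool} {r : ℝ} (h0 : 0 ≤ r) (h1 : r ≤ 1) :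
    (1 - r) • toPlane (base (bif b then (lightEnds l).2 else (lightEnds l).1)) +
      r • toPlane (bend l) ∈ triangle (lightPiece l b) := by
  refine ⟨![1 - r, r, 0], ?_, ?_, ?_⟩
  · intro i
    fin_cases i
    · simpa
    · simpa
    · simp
  · simp [Fin.sum_univ_three]
  · simp [Fin.sum_univ_three, lightPiece]

theorem lightArc_mem_false {l : Fin 8} {t : ℝ} (h0 : 0 ≤ t) (h1 : t ≤ 1 / 2) :
    lightArc l t ∈ triangle (lightPiece l false) := by
  rw [lightArc, if_pos h1]
  exact lightPiece_combo_mem (b := false) (by linarith) (by linarith)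

theorem lightArc_mem_true {l : Fin 8} {t : ℝ} (h0 : 1 / 2 < t) (h1 : t ≤ 1) :
    lightArc l t ∈ triangle (lightPiece l true) := by
  rw [lightArc, if_neg h0.not_ge]
  exact lightPiece_combo_mem (b := true) (by linarith) (by linarith)

theorem exists_lightArc_mem {l : Fin 8} {t : ℝ} (ht : t ∈ Icc (0 : ℝ) 1) :
    ∃ b, lightArc l t ∈ triangle (lightPiece l b) := by
  rcases le_or_gt t (1 / 2) with h | h
  · exact ⟨_, lightArc_mem_false ht.1 h⟩
  · exact ⟨_, lightArc_mem_true h ht.2⟩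

theorem heavyArc_mem {N : ℕ} {h : Fin 25} {k : Fin N} {b : Bool} {t : ℝ} (ht : t ∈ Icc (0 : ℝ) 1) :
    bundleArc (.inl (h, k, b)) t ∈ triangle (heavyTriangle h) := by
  refine heavyPoint_mem_triangle (mul_nonneg ht.1 (height_pos k).le) ?_
  rw [abs_mul, abs_endSign, one_mul, abs_of_nonneg (by linarith [ht.2])]
  have := mul_le_of_le_one_right ht.1 (height_lt_one k).le
  linarith

theorem heavyPoint_height_mem {N : ℕ} {h : Fin 25} {k : Fin N} :
    heavyPoint h 0 (height k) ∈ triangle (heavyTriangle h) :=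
  heavyPoint_mem_triangle (height_pos k).le (by simpa using (height_lt_one k).le)

theorem eq_heavyEnd {h : Fin 25} {x : Fin 12}
    (hx : toPlane (base x) ∈ triangle (heavyTriangle h)) : ∃ b, x = heavyEnd h b := by
  obtain ⟨i, j, hij, -⟩ := (sep_heavy_base h x).exists_eq hx (toPlane_mem_triangle _)
  rcases heavy_base_corner h x i hij with rfl | rfl
  · exact ⟨false, rfl⟩
  · exact ⟨true, rfl⟩

theorem heavyPoint_height_ne {N : ℕ} {h : Fin 25} {k : Fin N} {x : Fin 12} :
    heavyPoint h 0 (height k) ≠ toPlane (base x) := by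
  intro hx
  obtain ⟨b, rfl⟩ := eq_heavyEnd (hx ▸ heavyPoint_height_mem)
  rw [← heavyPoint_endSign] at hx
  exact (height_pos k).ne' (heavyPoint_inj hx).2

theorem exists_base_of_heavy_heavy {h h' : Fin 25} (hne : h ≠ h') {z : Plane}
    (hz : z ∈ triangle (heavyTriangle h)) (hz' : z ∈ triangle (heavyTriangle h')) :
    ∃ x, z = toPlane (base x) := by
  obtain ⟨i, j, hij, rfl⟩ := (sep_heavy_heavy h h' hne).exists_eq hz hz'
  obtain ⟨x, hx⟩ := heavy_heavy_corner h h' i j hne hij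
  exact ⟨x, by rw [hx]⟩

theorem exists_base_of_heavy_light {h : Fin 25} {l : Fin 8} {b : Bool} {z : Plane}
    (hz : z ∈ triangle (heavyTriangle h)) (hz' : z ∈ triangle (lightPiece l b)) :
    ∃ x, z = toPlane (base x) := by
  obtain ⟨i, j, hij, rfl⟩ := (sep_heavy_light h l b).exists_eq hz hz'
  obtain ⟨x, hx⟩ := heavy_light_corner h l b i j hij
  exact ⟨x, by rw [hx]⟩

theorem bundlePos_injective {N : ℕ} : Function.Injective (bundlePos (N := N)) := by
  rintro (x | ⟨h, k⟩) (x' | ⟨h', k'⟩) heq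
  · rw [base_injective (toPlane_injective heq)]
  · exact absurd heq.symm heavyPoint_height_ne
  · exact absurd heq heavyPoint_height_ne
  · change heavyPoint h 0 (height k) = heavyPoint h' 0 (height k') at heq
    by_cases hh : h = h'
    · subst hh
      rw [height_injective (heavyPoint_inj heq).2]
    · obtain ⟨x, hx⟩ := exists_base_of_heavy_heavy hh heavyPoint_height_mem
        (heq.symm ▸ heavyPoint_height_mem)
      exact absurd hx heavyPoint_height_ne

theorem continuous_bundleArc {N : ℕ} (ε : BundleEdge N) : Continuous (bundleArc ε) := by
  rcases ε with ⟨h, k, b⟩ | l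
  · change Continuous fun t => heavyPoint h (endSign b * (1 - t)) (t * height k)
    unfold heavyPoint
    fun_prop
  · change Continuous (lightArc l)
    unfold lightArc
    refine Continuous.if_le (by fun_prop) (by fun_prop) continuous_id continuous_const ?_
    rintro t rfl
    norm_num

theorem injOn_lightArc (l : Fin 8) : InjOn (lightArc l) (Icc 0 1) := by
  have hn : ∀ x, toPlane (base x) ≠ toPlane (bend l) := fun x h =>
    base_ne_bend x l (toPlane_injective h)
  have mixed : ∀ t t', 0 ≤ t → t ≤ 1 / 2 → 1 / 2 < t' → t' ≤ 1 → lightArc l t ≠ lightArc l t' := by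
    intro t t' h0 h1 h2 h3 heq
    obtain ⟨i, j, hij, hz⟩ := (sep_light l).exists_eq (lightArc_mem_false h0 h1)
      (heq ▸ lightArc_mem_true h2 h3)
    rw [light_corner l i j hij, heq, lightArc, if_neg h2.not_ge] at hz
    have h4 : toPlane (bend l) = (1 - (1 : ℝ)) • toPlane (base (lightEnds l).2) +
        (1 : ℝ) • toPlane (bend l) := by simp
    linarith [Drawing.injective_lineMap_of_ne (hn _) (hz.trans h4)]
  intro t ht t' ht' heq
  rcases le_or_gt t (1 / 2) with h | h <;> rcases le_or_gt t' (1 / 2) with h' | h'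
  · rw [lightArc, lightArc, if_pos h, if_pos h'] at heq
    linarith [Drawing.injective_lineMap_of_ne (hn _) heq]
  · exact absurd heq (mixed t t' ht.1 h h' ht'.2)
  · exact absurd heq.symm (mixed t' t ht'.1 h' h ht.2)
  · rw [lightArc, lightArc, if_neg h.not_ge, if_neg h'.not_ge] at heq
    linarith [Drawing.injective_lineMap_of_ne (hn _) heq]

theorem injOn_bundleArc {N : ℕ} (ε : BundleEdge N) : InjOn (bundleArc ε) (Icc 0 1) := by
  rcases ε with ⟨h, k, b⟩ | l
  · intro t _ t' _ heq
    have := mul_right_cancel₀ (height_pos k).ne' (heavyPoint_inj heq).2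
    exact this
  · exact injOn_lightArc l

theorem mem_of_bundlePos_mem {N : ℕ} (ε : BundleEdge N) (v : BundleVert N)
    (hv : bundlePos v ∈ bundleArc ε '' Icc 0 1) :
    v ∈ (bundleEdge ε : Sym2 (BundleVert N)) := by
  obtain ⟨t, ht, hv⟩ := hv
  rcases ε with ⟨h, k, b⟩ | l <;> rcases v with x | ⟨h', k'⟩
  · change _ = toPlane (base x) at hv
    obtain ⟨b', rfl⟩ := eq_heavyEnd (hv ▸ heavyArc_mem ht)
    rw [← heavyPoint_endSign] at hv
    obtain ⟨h1, h2⟩ := heavyPoint_inj hv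
    have ht0 : t = 0 := (mul_eq_zero.1 h2).resolve_right (height_pos k).ne'
    have : b = b' := by
      by_contra hb
      rw [endSign_eq hb, ht0] at h1
      have := endSign_mul_self b'
      nlinarith
    subst this
    simp [bundleEdge, bundleEnds]
  · change _ = heavyPoint h' 0 (height k') at hv
    by_cases hh : h = h'
    · subst hh
      obtain ⟨h1, h2⟩ := heavyPoint_inj hv
      have hs : endSign b ≠ 0 := fun h => by have := endSign_mul_self b; simp [h] at this
      have ht1 : t = 1 := by linarith [(mul_eq_zero.1 h1).resolve_left hs]
      rw [ht1, one_mul] at h2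
      rw [height_injective h2]
      simp [bundleEdge, bundleEnds]
    · obtain ⟨x, hx⟩ := exists_base_of_heavy_heavy hh (hv ▸ heavyArc_mem ht) heavyPoint_height_mem
      exact absurd hx heavyPoint_height_ne
  · obtain ⟨b, hb⟩ := exists_lightArc_mem (l := l) ht
    change lightArc l t = toPlane (base x) at hv
    obtain ⟨i, j, hij, -⟩ := (sep_light_base l b x).exists_eq (hv ▸ hb) (toPlane_mem_triangle _)
    rcases light_base_corner l b x i hij with rfl | rfl <;> simp [bundleEdge, bundleEnds]
  · obtain ⟨b, hb⟩ := exists_lightArc_mem (l := l) ht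
    change lightArc l t = heavyPoint h' 0 (height k') at hv
    obtain ⟨x, hx⟩ := exists_base_of_heavy_light heavyPoint_height_mem (hv ▸ hb)
    exact absurd hx heavyPoint_height_ne

theorem bundleArc_inter {N : ℕ} {ε ε' : BundleEdge N} (hne : ε ≠ ε') {t t' : ℝ}
    (ht : t ∈ Ioo (0 : ℝ) 1) (ht' : t' ∈ Ioo (0 : ℝ) 1) (heq : bundleArc ε t = bundleArc ε' t') :
    (∃ x, bundleArc ε t = toPlane (base x)) ∨
      ∃ l : Fin 8, ε = .inr l ∧ ε' = .inr (l + 4) ∧ bundleArc ε t ∈ triangle (lightPiece l true) ∧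
        bundleArc ε t ∈ triangle (lightPiece (l + 4) true) := by
  have hti := Ioo_subset_Icc_self ht
  have hti' := Ioo_subset_Icc_self ht'
  rcases ε with ⟨h, k, b⟩ | l <;> rcases ε' with ⟨h', k', b'⟩ | l'
  · by_cases hh : h = h'
    · subst hh
      exfalso
      obtain ⟨h1, h2⟩ := heavyPoint_inj heq
      by_cases hb : b = b'
      · subst hb
        have hs : endSign b ≠ 0 := fun h => by have := endSign_mul_self b; simp [h] at this
        have htt : t = t' := by linarith [mul_left_cancel₀ hs h1]
        subst htt
        exact hne (by rw [height_injective (mul_left_cancel₀ ht.1.ne' h2)])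
      · rw [endSign_eq hb] at h1
        have hs : endSign b' ≠ 0 := fun h => by have := endSign_mul_self b'; simp [h] at this
        have : endSign b' * ((1 - t) + (1 - t')) = 0 := by linear_combination -h1
        have := (mul_eq_zero.1 this).resolve_left hs
        linarith [ht.2, ht'.2]
    · exact Or.inl (exists_base_of_heavy_heavy hh (heavyArc_mem hti) (heq ▸ heavyArc_mem hti'))
  · obtain ⟨c, hc⟩ := exists_lightArc_mem (l := l') hti'
    change bundleArc (.inr l' : BundleEdge N) t' ∈ _ at hc
    exact Or.inl (exists_base_of_heavy_light (heavyArc_mem hti) (b := c) (heq.symm ▸ hc))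
  · obtain ⟨c, hc⟩ := exists_lightArc_mem (l := l) hti
    exact Or.inl (exists_base_of_heavy_light (heq.symm ▸ heavyArc_mem hti') (b := c) hc)
  · obtain ⟨c, hc⟩ := exists_lightArc_mem (l := l) hti
    obtain ⟨c', hc'⟩ := exists_lightArc_mem (l := l') hti'
    change bundleArc (.inr l : BundleEdge N) t ∈ _ at hc
    change bundleArc (.inr l' : BundleEdge N) t' ∈ _ at hc'
    rw [← heq] at hc'
    have hll : l ≠ l' := fun h => hne (by rw [h])
    rcases sep_light_light l l' c c' hll with ⟨rfl, rfl, rfl⟩ | hsep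
    · exact Or.inr ⟨l, rfl, rfl, hc, hc'⟩
    · obtain ⟨i, j, hij, hz⟩ := hsep.exists_eq hc hc'
      obtain ⟨x, hx⟩ := light_light_corner l l' c c' i j hll hij
      exact Or.inl ⟨x, by rw [← hx]; exact hz⟩

theorem exists_eq_of_mem_lightPiece {l : Fin 8} {z : Plane}
    (hz : z ∈ triangle (lightPiece l true)) :
    ∃ r : ℝ, z = toPlane (bend l) + r • (toPlane (base (lightEnds l).2) - toPlane (bend l)) := by
  obtain ⟨c, -, c1, rfl⟩ := hz
  refine ⟨c 0, ?_⟩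
  simp only [Fin.sum_univ_three] at c1 ⊢
  obtain h : c 1 + c 2 = 1 - c 0 := by linarith
  simp only [lightPiece, Matrix.cons_val, cond_true]
  rw [add_assoc, ← add_smul, h]
  module

theorem lightPiece_inter {l : Fin 8} {z z' : Plane}
    (h1 : z ∈ triangle (lightPiece l true)) (h2 : z ∈ triangle (lightPiece (l + 4) true))
    (h1' : z' ∈ triangle (lightPiece l true)) (h2' : z' ∈ triangle (lightPiece (l + 4) true)) :
    z = z' := by
  obtain ⟨r, hr⟩ := exists_eq_of_mem_lightPiece h1
  obtain ⟨s, hs⟩ := exists_eq_of_mem_lightPiece h2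
  obtain ⟨r', hr'⟩ := exists_eq_of_mem_lightPiece h1'
  obtain ⟨s', hs'⟩ := exists_eq_of_mem_lightPiece h2'
  have hdet := cross_light l
  rw [← Int.cast_ne_zero (α := ℝ)] at hdet
  push_cast at hdet
  have e1 : z.1 - z'.1 = _ := congrArg₂ (fun a b : Plane => a.1 - b.1) hr hr'
  have e2 : z.2 - z'.2 = _ := congrArg₂ (fun a b : Plane => a.2 - b.2) hr hr'
  have e3 : z.1 - z'.1 = _ := congrArg₂ (fun a b : Plane => a.1 - b.1) hs hs'
  have e4 : z.2 - z'.2 = _ := congrArg₂ (fun a b : Plane => a.2 - b.2) hs hs'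
  simp only [toPlane, Prod.fst_add, Prod.snd_add, Prod.smul_fst, Prod.smul_snd, Prod.fst_sub,
    Prod.snd_sub, smul_eq_mul] at e1 e2 e3 e4
  generalize ((base (lightEnds l).2).1 : ℝ) = a1 at *
  generalize ((base (lightEnds l).2).2 : ℝ) = a2 at *
  generalize ((bend l).1 : ℝ) = b1 at *
  generalize ((bend l).2 : ℝ) = b2 at *
  generalize ((base (lightEnds (l + 4)).2).1 : ℝ) = c1 at *
  generalize ((base (lightEnds (l + 4)).2).2 : ℝ) = c2 at *
  generalize ((bend (l + 4)).1 : ℝ) = d1 at *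
  generalize ((bend (l + 4)).2 : ℝ) = d2 at *
  have hrr : (r - r') = 0 := by
    refine (mul_eq_zero.1 ?_).resolve_right hdet
    linear_combination (c2 - d2) * (e3 - e1) - (c1 - d1) * (e4 - e2)
  rw [hr, hr', sub_eq_zero.1 hrr]

/-- The bundled graph has a drawing with at most four crossings. -/
theorem exists_drawing_bundleGraph (N : ℕ) :
    ∃ D : Drawing (bundleGraph N), D.CrossSet.Finite ∧ D.CrossSet.ncard ≤ 4 := by
  have hidx : ∀ e : (bundleGraph N).edgeSet, ∃ ε, bundleEdge ε = e := fun e => by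
    obtain ⟨ε, hε⟩ := exists_of_mem_edgeGraph e
    exact ⟨ε, Subtype.ext hε.symm⟩
  choose idx hidx using hidx
  let D : Drawing (bundleGraph N) := .ofArcs bundlePos bundlePos_injective
    (fun e => bundleArc (idx e)) (fun e => (continuous_bundleArc _).continuousOn)
    (fun e => injOn_bundleArc _) (fun e => by
      obtain ⟨ε, hε⟩ : ∃ ε, idx e = ε := ⟨_, rfl⟩
      refine ⟨(bundleEnds N ε).1, (bundleEnds N ε).2, by rw [← hidx e, hε]; rfl, ?_⟩
      rw [hε]
      rcases ε with ⟨h, k, b⟩ | l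
      · simp [bundleArc, bundleEnds, bundlePos, heavyPoint_endSign]
      · constructor
        · simp [bundleArc, bundleEnds, bundlePos, lightArc]
        · simp [bundleArc, bundleEnds, bundlePos, lightArc]
          norm_num)
    (fun e v hv => by
      have := mem_of_bundlePos_mem _ _ hv
      rwa [hidx] at this)
  have key : ∀ x ∈ D.CrossSet, ∃ l : Fin 8,
      x.2 = s(bundleEdge (.inr l), bundleEdge (.inr (l + 4))) ∧
      x.1 ∈ triangle (lightPiece l true) ∧ x.1 ∈ triangle (lightPiece (l + 4) true) := by
    rintro ⟨z, p⟩ ⟨e, f, hef, hp, ⟨t, ht, hz⟩, ⟨t', ht', hz'⟩⟩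
    simp only at hp hz hz' ⊢
    have hne : idx e ≠ idx f := fun h => hef (by rw [← hidx e, ← hidx f, h])
    rcases bundleArc_inter hne ht ht' (hz.trans hz'.symm) with ⟨x, hx⟩ | ⟨l, h1, h2, h3, h4⟩
    · have := D.arc_avoid e t (Ioo_subset_Icc_self ht) ⟨.inl x, hx⟩
      rcases this with rfl | rfl
      · exact absurd ht.1 (lt_irrefl _)
      · exact absurd ht.2 (lt_irrefl _)
    · refine ⟨l, ?_, ?_, ?_⟩
      · rw [hp, ← h1, ← h2, hidx, hidx]
      · rw [← hz]; exact h3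
      · rw [← hz]; exact h4
  have hlow : ∀ l : Fin 8, ∃ i : Fin 4, l = i.castLE (by norm_num) ∨
      l = i.castLE (by norm_num : 4 ≤ 8) + 4 := by decide
  have hadd : ∀ l : Fin 8, l + 4 + 4 = l := by decide
  have key' : ∀ x : D.CrossSet, ∃ i : Fin 4, ∃ l : Fin 8, l = i.castLE (by norm_num) ∧
      x.1.2 = s(bundleEdge (.inr l), bundleEdge (.inr (l + 4))) ∧
      x.1.1 ∈ triangle (lightPiece l true) ∧ x.1.1 ∈ triangle (lightPiece (l + 4) true) := by
    intro x
    obtain ⟨l, h1, h2, h3⟩ := key x.1 x.2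
    obtain ⟨i, hi | hi⟩ := hlow l
    · exact ⟨i, l, hi, h1, h2, h3⟩
    · refine ⟨i, l + 4, by rw [hi, hadd], ?_, h3, ?_⟩
      · rw [h1, hadd, Sym2.eq_swap]
      · rwa [hadd]
  choose g hg using key'
  have hginj : Function.Injective g := by
    intro x y hxy
    obtain ⟨l, hl, h1, h2, h3⟩ := hg x
    obtain ⟨l', hl', h1', h2', h3'⟩ := hg y
    obtain rfl : l = l' := by rw [hl, hl', hxy]
    exact Subtype.ext (Prod.ext (lightPiece_inter h2 h3 h2' h3') (h1.trans h1'.symm))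
  refine ⟨D, Set.finite_coe_iff.1 ?_, ?_⟩
  · exact Finite.of_injective g hginj
  · have := Nat.card_le_card_of_injective g hginj
    rwa [Nat.card_coe_set_eq, Nat.card_eq_fintype_card, Fintype.card_fin] at this

namespace Drawing

variable {V W : Type*} {G : SimpleGraph V} {H : SimpleGraph W}

/-- The restriction of a drawing along an injective homomorphism. -/
def comap (D : Drawing H) (φ : G →g H) (hφ : Function.Injective φ) : Drawing G where
  vert := D.vert ∘ φ
  vert_inj := D.vert_inj.comp hφ
  arc e := D.arc (φ.mapEdgeSet e)
  arc_cont e := D.arc_cont _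
  arc_injOn e := D.arc_injOn _
  arc_ends := by
    rintro ⟨e, he⟩
    obtain ⟨x, y, hxy, h0, h1⟩ := D.arc_ends (φ.mapEdgeSet ⟨e, he⟩)
    induction e using Sym2.ind with
    | _ a b =>
      change s(φ a, φ b) = s(x, y) at hxy
      rcases Sym2.eq_iff.1 hxy with ⟨rfl, rfl⟩ | ⟨rfl, rfl⟩
      · exact ⟨a, b, rfl, h0, h1⟩
      · exact ⟨b, a, Sym2.eq_swap, h0, h1⟩
  arc_avoid := by
    rintro e t ht ⟨v, hv⟩
    exact D.arc_avoid _ t ht ⟨φ v, hv⟩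

variable {D : Drawing H} {φ : G →g H} {hφ : Function.Injective φ}

theorem IsRectilinear.comap (hD : D.IsRectilinear) : (D.comap φ hφ).IsRectilinear :=
  fun _ t ht => hD _ t ht

theorem mem_crossSet_comap {x : Plane × Sym2 G.edgeSet} (hx : x ∈ (D.comap φ hφ).CrossSet) :
    Prod.map id (Sym2.map φ.mapEdgeSet) x ∈ D.CrossSet := by
  obtain ⟨e, f, hef, hp, h1, h2⟩ := hx
  exact ⟨_, _, (SimpleGraph.Hom.mapEdgeSet.injective φ hφ).ne hef, by simp [hp], h1, h2⟩

theorem crossSet_map_injective (φ : G →g H) (hφ : Function.Injective φ) :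
    Function.Injective (Prod.map (id : Plane → Plane) (Sym2.map φ.mapEdgeSet)) :=
  Function.injective_id.prodMap (Sym2.map.injective (SimpleGraph.Hom.mapEdgeSet.injective φ hφ))

theorem finite_crossSet_comap (h : D.CrossSet.Finite) : (D.comap φ hφ).CrossSet.Finite :=
  Set.Finite.of_injOn (fun _ hx => mem_crossSet_comap hx) (crossSet_map_injective φ hφ).injOn h

theorem ncard_crossSet_comap_le (h : D.CrossSet.Finite) :
    (D.comap φ hφ).CrossSet.ncard ≤ D.CrossSet.ncard :=
  ncard_le_ncard_of_injOn _ (fun _ hx => mem_crossSet_comap hx)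
    (crossSet_map_injective φ hφ).injOn h

end Drawing

theorem crNum_le {V : Type*} {G : SimpleGraph V} (D : Drawing G) (h : D.CrossSet.Finite) :
    crNum G ≤ D.CrossSet.ncard :=
  Nat.sInf_le ⟨D, trivial, h, rfl⟩

theorem exists_ncard_eq_crNum {V : Type*} {G : SimpleGraph V}
    (h : ∃ D : Drawing G, D.CrossSet.Finite) :
    ∃ D : Drawing G, D.CrossSet.Finite ∧ D.CrossSet.ncard = crNum G := by
  obtain ⟨D, hD⟩ := h
  obtain ⟨D', -, h1, h2⟩ := Nat.sInf_mem (s := { n | ∃ D : Drawing G, True ∧ D.CrossSet.Finite ∧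
    D.CrossSet.ncard = n }) ⟨_, D, trivial, hD, rfl⟩
  exact ⟨D', h1, h2⟩

theorem crNum_congr {V W : Type*} {G : SimpleGraph V} {H : SimpleGraph W} (e : G ≃g H)
    (h : ∃ D : Drawing G, D.CrossSet.Finite) : crNum H = crNum G := by
  obtain ⟨D, hD, hc⟩ := exists_ncard_eq_crNum h
  have hD' := Drawing.finite_crossSet_comap (φ := e.symm.toHom) (hφ := e.symm.injective) hD
  refine le_antisymm ?_ ?_
  · rw [← hc]
    exact (crNum_le _ hD').trans (Drawing.ncard_crossSet_comap_le hD)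
  · obtain ⟨E, hE, hc'⟩ := exists_ncard_eq_crNum ⟨_, hD'⟩
    rw [← hc']
    exact (crNum_le _ (Drawing.finite_crossSet_comap (φ := e.toHom) (hφ := e.injective) hE)).trans
      (Drawing.ncard_crossSet_comap_le hE)

/-- Every drawing of the complete graph on five vertices has a crossing. -/
theorem Drawing.crossSet_nonempty (D : Drawing (⊤ : SimpleGraph (Fin 5))) :
    D.CrossSet.Nonempty := by
  classical
  obtain ⟨i, j, k, l, hij, hkl, hik, hjk, hjl, z, hz, hz'⟩ := exists_independent_sets_meet D.vert
    (fun i j => if h : i ≠ j then D.arcSet ⟨s(i, j), h⟩ else ∅) (fun i j hij => by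
      simp only [dif_pos hij.ne]
      exact D.joinedIn_arcSet rfl)
  simp only [dif_pos hij.ne, dif_pos hkl.ne] at hz hz'
  have hil : i ≠ l := (hik.trans hkl).ne
  have hik := hik.ne
  rcases D.vert_or_mem_crossSet (by
    intro h
    have := congrArg Subtype.val h
    simp only [Sym2.eq_iff] at this
    tauto) hz hz' with ⟨v, hv, hv', -⟩ | h
  · simp only [Sym2.mem_iff] at hv hv'
    rcases hv with rfl | rfl <;> tauto
  · exact ⟨_, h⟩

/-- The inclusion of the first graph in a disjoint union. -/
abbrev inlHom {V W : Type*} (G : SimpleGraph V) (H : SimpleGraph W) : G →g G ⊕g H :=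
  SimpleGraph.Embedding.sumInl.toHom

/-- The inclusion of the second graph in a disjoint union. -/
abbrev inrHom {V W : Type*} (G : SimpleGraph V) (H : SimpleGraph W) : H →g G ⊕g H :=
  SimpleGraph.Embedding.sumInr.toHom

theorem Drawing.ncard_comap_add_one_le {V : Type*} {G : SimpleGraph V}
    (D : Drawing (G ⊕g (⊤ : SimpleGraph (Fin 5)))) (hD : D.CrossSet.Finite) :
    (D.comap (inlHom G ⊤) Sum.inl_injective).CrossSet.ncard + 1 ≤ D.CrossSet.ncard := by
  set φ := inlHom G (⊤ : SimpleGraph (Fin 5))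
  set ψ := inrHom G (⊤ : SimpleGraph (Fin 5))
  have hφ : Function.Injective φ := Sum.inl_injective
  have hψ : Function.Injective ψ := Sum.inr_injective
  obtain ⟨x, hx⟩ := (D.comap ψ hψ).crossSet_nonempty
  have hsub : insert (Prod.map id (Sym2.map ψ.mapEdgeSet) x)
      (Prod.map id (Sym2.map φ.mapEdgeSet) '' (D.comap φ hφ).CrossSet) ⊆ D.CrossSet := by
    rw [insert_subset_iff]
    refine ⟨Drawing.mem_crossSet_comap hx, ?_⟩
    rintro _ ⟨y, hy, rfl⟩
    exact Drawing.mem_crossSet_comap hy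
  have hnot : Prod.map id (Sym2.map ψ.mapEdgeSet) x ∉
      Prod.map id (Sym2.map φ.mapEdgeSet) '' (D.comap φ hφ).CrossSet := by
    rintro ⟨⟨z, p⟩, -, hy⟩
    have hp := congrArg Prod.snd hy
    obtain ⟨z', q⟩ := x
    simp only [Prod.map_snd] at hp
    induction p using Sym2.ind with
    | _ e f =>
    have hmem : φ.mapEdgeSet e ∈ Sym2.map ψ.mapEdgeSet q := by
      rw [← hp]; simp
    obtain ⟨e', -, he'⟩ := Sym2.mem_map.1 hmem
    obtain ⟨e, he⟩ := e
    obtain ⟨e', he''⟩ := e'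
    have := congrArg Subtype.val he'
    induction e using Sym2.ind with
    | _ a b =>
    induction e' using Sym2.ind with
    | _ c d =>
      change s((Sum.inr c : V ⊕ Fin 5), Sum.inr d) = s(Sum.inl a, Sum.inl b) at this
      simp at this
  have := ncard_le_ncard hsub hD
  rwa [ncard_insert_of_notMem hnot (hD.subset ((subset_insert _ _).trans hsub)),
    ncard_image_of_injective _ (Drawing.crossSet_map_injective φ hφ)] at this

theorem exists_mapEdgeSet_eq {V W : Type*} {G : SimpleGraph V} {H : SimpleGraph W}
    (e : (G ⊕g H).edgeSet) :
    ∃ i : G.edgeSet ⊕ H.edgeSet, i.elim (inlHom G H).mapEdgeSet (inrHom G H).mapEdgeSet = e := by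
  obtain ⟨e, he⟩ := e
  induction e using Sym2.ind with
  | _ a b =>
    rcases a with a | a <;> rcases b with b | b
    · exact ⟨.inl ⟨s(a, b), by simpa using he⟩, rfl⟩
    · simp at he
    · simp at he
    · exact ⟨.inr ⟨s(a, b), by simpa using he⟩, rfl⟩

namespace Drawing

variable {V W : Type*} {G : SimpleGraph V} {H : SimpleGraph W}

/-- The points of a drawing. -/
def support (D : Drawing G) : Set Plane := range D.vert ∪ ⋃ e, D.arcSet e

theorem bddAbove_fst_support [Finite V] (D : Drawing G) : BddAbove (Prod.fst '' D.support) := by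
  have hc : IsCompact D.support :=
    (finite_range D.vert).isCompact.union
      (isCompact_iUnion fun e => isCompact_Icc.image_of_continuousOn (D.arc_cont e))
  exact (hc.image continuous_fst).bddAbove

theorem exists_sum (D : Drawing G) (E : Drawing H) (hDE : Disjoint D.support E.support)
    (hD : D.CrossSet.Finite) (hE : E.CrossSet.Finite) :
    ∃ F : Drawing (G ⊕g H), F.CrossSet.Finite ∧
      F.CrossSet.ncard ≤ D.CrossSet.ncard + E.CrossSet.ncard := by
  choose idx hidx using exists_mapEdgeSet_eq (G := G) (H := H)
  have hvD : ∀ v, D.vert v ∈ D.support := fun v => .inl ⟨v, rfl⟩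
  have hvE : ∀ v, E.vert v ∈ E.support := fun v => .inl ⟨v, rfl⟩
  have haD : ∀ e, D.arcSet e ⊆ D.support := fun e => (subset_iUnion _ e).trans subset_union_right
  have haE : ∀ e, E.arcSet e ⊆ E.support := fun e => (subset_iUnion _ e).trans subset_union_right
  have hne : ∀ {z w}, z ∈ D.support → w ∈ E.support → z ≠ w := fun hz hw h =>
    disjoint_left.1 hDE hz (h ▸ hw)
  let F : Drawing (G ⊕g H) := .ofArcs (Sum.elim D.vert E.vert)
    (D.vert_inj.sumElim E.vert_inj fun a b => hne (hvD a) (hvE b))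
    (fun e => Sum.elim D.arc E.arc (idx e))
    (fun e => by
      rcases idx e with i | i
      · exact D.arc_cont i
      · exact E.arc_cont i)
    (fun e => by
      rcases idx e with i | i
      · exact D.arc_injOn i
      · exact E.arc_injOn i)
    (fun e => by
      have h := hidx e
      generalize idx e = i at h ⊢
      rcases i with i | i
      · obtain ⟨x, y, hxy, h0, h1⟩ := D.arc_ends i
        refine ⟨.inl x, .inl y, ?_, h0, h1⟩
        rw [← h]
        change Sym2.map Sum.inl i.1 = _
        rw [hxy]; rfl
      · obtain ⟨x, y, hxy, h0, h1⟩ := E.arc_ends i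
        refine ⟨.inr x, .inr y, ?_, h0, h1⟩
        rw [← h]
        change Sym2.map Sum.inr i.1 = _
        rw [hxy]; rfl)
    (fun e v hv => by
      have h := hidx e
      generalize idx e = i at h hv
      rcases i with i | i <;> rcases v with v | v
      · rw [← h]
        exact Sym2.mem_map.2 ⟨v, D.mem_of_vert_mem_arcSet hv, rfl⟩
      · exact absurd rfl (hne (haD i hv) (hvE v))
      · exact absurd rfl (hne (hvD v) (haE i hv))
      · rw [← h]
        exact Sym2.mem_map.2 ⟨v, E.mem_of_vert_mem_arcSet hv, rfl⟩)
  have hsub : F.CrossSet ⊆ Prod.map id (Sym2.map (inlHom G H).mapEdgeSet) '' D.CrossSet ∪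
      Prod.map id (Sym2.map (inrHom G H).mapEdgeSet) '' E.CrossSet := by
    rintro ⟨z, p⟩ ⟨e, f, hef, hp, h1, h2⟩
    simp only at hp h1 h2
    have he := hidx e
    have hf := hidx f
    change z ∈ Sum.elim D.arc E.arc (idx e) '' Ioo 0 1 at h1
    change z ∈ Sum.elim D.arc E.arc (idx f) '' Ioo 0 1 at h2
    generalize idx e = i at he h1
    generalize idx f = j at hf h2
    rcases i with i | i <;> rcases j with j | j
    · exact .inl ⟨(z, s(i, j)), ⟨i, j, by rintro rfl; exact hef (he.symm.trans hf), rfl, h1, h2⟩,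
        by rw [hp, ← he, ← hf]; rfl⟩
    · exact absurd rfl (hne (haD i (D.interOf_subset_arcSet i h1))
        (haE j (E.interOf_subset_arcSet j h2)))
    · exact absurd rfl (hne (haD j (D.interOf_subset_arcSet j h2))
        (haE i (E.interOf_subset_arcSet i h1)))
    · exact .inr ⟨(z, s(i, j)), ⟨i, j, by rintro rfl; exact hef (he.symm.trans hf), rfl, h1, h2⟩,
        by rw [hp, ← he, ← hf]; rfl⟩
  have hfin := (hD.image (Prod.map id (Sym2.map (inlHom G H).mapEdgeSet))).union
    (hE.image (Prod.map id (Sym2.map (inrHom G H).mapEdgeSet)))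
  refine ⟨F, hfin.subset hsub, (ncard_le_ncard hsub hfin).trans ((ncard_union_le _ _).trans ?_)⟩
  exact add_le_add (ncard_image_le hD) (ncard_image_le hE)

end Drawing

/-- The positions of the vertices in a drawing of the complete graph with one crossing. -/
def completePos : Fin 5 → ℤ × ℤ := ![(27, 10), (3, 18), (21, 19), (27, 22), (10, 17)]

/-- The edges of that drawing, as degenerate triangles. -/
def completeEdge (i j : Fin 5) : Fin 3 → ℤ × ℤ := ![completePos i, completePos j, completePos j]

theorem isSep_completeEdge : ∀ i j k l, i < j → k < l → (i, j) ≠ (k, l) →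
    (i, j, k, l) = (1, 2, 3, 4) ∨ (k, l, i, j) = (1, 2, 3, 4) ∨
      IsSep (completeEdge i j) (completeEdge k l) := by
  decide +kernel

theorem isSep_completePos : ∀ i j k, i < j → IsSep (completeEdge i j) fun _ => completePos k := by
  decide +kernel

theorem completePos_injective : Function.Injective completePos := by
  have : ∀ x y, completePos x = completePos y → x = y := by decide +kernel
  exact this

theorem completeEdge_corner : ∀ i j a, ∃ k ∈ s(i, j), completeEdge i j a = completePos k := by
  decide +kernel

theorem sub_mem_triangle_completeEdge {i j : Fin 5} {z w : Plane}
    (hz : z ∈ segment ℝ (toPlane (completePos i) + w) (toPlane (completePos j) + w)) :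
    z - w ∈ triangle (completeEdge i j) := by
  obtain ⟨s, t, hs, ht, hst, rfl⟩ := hz
  refine ⟨![s, t, 0], ?_, by simp [Fin.sum_univ_three, hst], ?_⟩
  · intro a
    fin_cases a <;> simp [hs, ht]
  · have : s • w + t • w = w := by rw [← add_smul, hst, one_smul]
    simp only [Fin.sum_univ_three, completeEdge, Matrix.cons_val, zero_smul, add_zero, smul_add]
    rw [add_add_add_comm, this, add_sub_cancel_right]

theorem eq_of_mem_triangle_completeEdge {z z' : Plane}
    (h1 : z ∈ triangle (completeEdge 1 2)) (h2 : z ∈ triangle (completeEdge 3 4))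
    (h1' : z' ∈ triangle (completeEdge 1 2)) (h2' : z' ∈ triangle (completeEdge 3 4)) :
    z = z' := by
  have l1 : ∀ z ∈ triangle (completeEdge 1 2), z.1 - 18 * z.2 = -321 := by
    rintro _ ⟨c, -, hc, rfl⟩
    simp only [Fin.sum_univ_three] at hc
    simp [Fin.sum_univ_three, completeEdge, completePos, toPlane]
    linarith
  have l2 : ∀ z ∈ triangle (completeEdge 3 4), 5 * z.1 - 17 * z.2 = -239 := by
    rintro _ ⟨c, -, hc, rfl⟩
    simp only [Fin.sum_univ_three] at hc
    simp [Fin.sum_univ_three, completeEdge, completePos, toPlane]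
    linarith
  have e1 := l1 z h1
  have e2 := l2 z h2
  have e3 := l1 z' h1'
  have e4 := l2 z' h2'
  exact Prod.ext (by linarith) (by linarith)

/-- The complete graph on five vertices has a drawing with at most one crossing arbitrarily far to
the right. -/
theorem exists_drawing_complete (R : ℝ) :
    ∃ E : Drawing (⊤ : SimpleGraph (Fin 5)), E.CrossSet.Finite ∧ E.CrossSet.ncard ≤ 1 ∧
      ∀ z ∈ E.support, R ≤ z.1 := by
  set w : Plane := (R, 0)
  have hinj : Function.Injective fun i => toPlane (completePos i) + w :=
    (add_left_injective w).comp (toPlane_injective.comp completePos_injective)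
  have hlt : ∀ i j v : Fin 5, i < j → v ≠ i → v ≠ j → toPlane (completePos v) + w ∉
      segment ℝ (toPlane (completePos i) + w) (toPlane (completePos j) + w) := by
    intro i j v hij hvi hvj hv
    have h := sub_mem_triangle_completeEdge hv
    rw [add_sub_cancel_right] at h
    obtain ⟨a, b, hab, -⟩ := (isSep_completePos i j v hij).exists_eq h
      (toPlane_mem_triangle (completePos v))
    obtain ⟨k, hk, hk'⟩ := completeEdge_corner i j a
    obtain rfl : k = v := completePos_injective (hk'.symm.trans hab)
    rw [Sym2.mem_iff] at hk
    tauto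
  obtain ⟨E, hv, hE⟩ := Drawing.exists_isRectilinear (G := (⊤ : SimpleGraph (Fin 5)))
    (fun i => toPlane (completePos i) + w) hinj (by
      intro i j v hij hvi hvj
      rcases lt_or_gt_of_ne hij.ne with h | h
      · exact hlt i j v h hvi hvj
      · rw [segment_symm]
        exact hlt j i v h hvj hvi)
  have hedge : ∀ e : (⊤ : SimpleGraph (Fin 5)).edgeSet,
      ∃ i j, i < j ∧ (e : Sym2 (Fin 5)) = s(i, j) := by
    rintro ⟨e, he⟩
    induction e using Sym2.ind with
    | _ i j =>
      have hij : i ≠ j := he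
      rcases lt_or_gt_of_ne hij with h | h
      · exact ⟨i, j, h, rfl⟩
      · exact ⟨j, i, h, Sym2.eq_swap⟩
  have hmem : ∀ {e : (⊤ : SimpleGraph (Fin 5)).edgeSet} {i j z},
      (e : Sym2 (Fin 5)) = s(i, j) → z ∈ E.interOf e → z - w ∈ triangle (completeEdge i j) := by
    intro e i j z he hz
    have := E.interOf_subset_arcSet e hz
    rw [hE.arcSet_eq he, hv] at this
    exact sub_mem_triangle_completeEdge this
  have key : ∀ x ∈ E.CrossSet, x.1 - w ∈ triangle (completeEdge 1 2) ∧
      x.1 - w ∈ triangle (completeEdge 3 4) ∧ Sym2.map Subtype.val x.2 = s(s(1, 2), s(3, 4)) := by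
    rintro ⟨z, p⟩ ⟨e, f, hef, hp, hz, hz'⟩
    simp only at hp hz hz' ⊢
    obtain ⟨i, j, hij, he⟩ := hedge e
    obtain ⟨k, l, hkl, hf⟩ := hedge f
    have h1 := hmem he hz
    have h2 := hmem hf hz'
    have hne : (i, j) ≠ (k, l) := by
      intro h
      rw [Prod.mk.injEq] at h
      exact hef (Subtype.ext (by rw [he, hf, h.1, h.2]))
    rcases isSep_completeEdge i j k l hij hkl hne with h | h | h
    · simp only [Prod.mk.injEq] at h
      obtain ⟨rfl, rfl, rfl, rfl⟩ := h
      exact ⟨h1, h2, by rw [hp, Sym2.map_mk, he, hf]⟩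
    · simp only [Prod.mk.injEq] at h
      obtain ⟨rfl, rfl, rfl, rfl⟩ := h
      exact ⟨h2, h1, by rw [hp, Sym2.map_mk, he, hf, Sym2.eq_swap]⟩
    · obtain ⟨a, b, -, hz0⟩ := h.exists_eq h1 h2
      obtain ⟨v, -, hv'⟩ := completeEdge_corner i j a
      obtain ⟨t, ht, rfl⟩ := hz
      have := E.arc_avoid e t (Ioo_subset_Icc_self ht) ⟨v, by
        simp only [hv]
        rw [← hv', ← hz0, sub_add_cancel]⟩
      rcases this with rfl | rfl
      · exact absurd ht.1 (lt_irrefl _)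
      · exact absurd ht.2 (lt_irrefl _)
  have hsub : E.CrossSet.Subsingleton := by
    intro x hx y hy
    obtain ⟨h1, h2, h3⟩ := key x hx
    obtain ⟨h1', h2', h3'⟩ := key y hy
    exact Prod.ext (sub_left_injective (eq_of_mem_triangle_completeEdge h1 h2 h1' h2'))
      (Sym2.map.injective Subtype.val_injective (h3.trans h3'.symm))
  refine ⟨E, hsub.finite, ?_, ?_⟩
  · have := hsub.finite.to_subtype
    exact ncard_le_one_iff_subsingleton.2 hsub
  have hvert : ∀ v, R ≤ (E.vert v).1 := by
    have hpos : ∀ i, 0 ≤ (completePos i).1 := by decide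
    intro v
    have : (0 : ℝ) ≤ (completePos v).1 := by exact_mod_cast hpos v
    rw [hv]
    simpa [w, toPlane] using this
  rintro z (⟨v, rfl⟩ | hz)
  · exact hvert v
  · obtain ⟨e, he⟩ := mem_iUnion.1 hz
    obtain ⟨i, j, -, hij⟩ := hedge e
    rw [hE.arcSet_eq hij] at he
    have hconv : Convex ℝ {z : Plane | R ≤ z.1} :=
      (convex_Ici R).is_linear_preimage (IsLinearMap.mk (fun _ _ => rfl) fun _ _ => rfl)
    exact hconv.segment_subset (hvert i) (hvert j) he

theorem exists_sum_complete {V : Type*} [Finite V] {G : SimpleGraph V} {m : ℕ}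
    (h : ∃ D : Drawing G, D.CrossSet.Finite)
    (hr : ∀ D : Drawing G, D.IsRectilinear → D.CrossSet.Finite → m ≤ D.CrossSet.ncard) :
    crNum (G ⊕g (⊤ : SimpleGraph (Fin 5))) = crNum G + 1 ∧
      (∃ D : Drawing (G ⊕g (⊤ : SimpleGraph (Fin 5))), D.CrossSet.Finite) ∧
      ∀ D : Drawing (G ⊕g (⊤ : SimpleGraph (Fin 5))), D.IsRectilinear → D.CrossSet.Finite →
        m ≤ D.CrossSet.ncard := by
  obtain ⟨D, hD, hc⟩ := exists_ncard_eq_crNum h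
  obtain ⟨R, hR⟩ := D.bddAbove_fst_support
  obtain ⟨E, hE, hE1, hER⟩ := exists_drawing_complete (R + 1)
  obtain ⟨F, hF, hF1⟩ := D.exists_sum E (disjoint_left.2 fun z hz hz' => by
    linarith [hR ⟨z, hz, rfl⟩, hER z hz']) hD hE
  refine ⟨le_antisymm ?_ ?_, ⟨F, hF⟩, fun D hD hfin => ?_⟩
  · have := crNum_le F hF
    lia
  · obtain ⟨D', hD', hc'⟩ := exists_ncard_eq_crNum ⟨F, hF⟩
    have h1 := D'.ncard_comap_add_one_le hD'
    have h2 := crNum_le (D'.comap (inlHom G ⊤) Sum.inl_injective)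
      (Drawing.finite_crossSet_comap hD')
    lia
  · exact (hr _ (hD.comap (φ := inlHom G ⊤) (hφ := Sum.inl_injective))
      (Drawing.finite_crossSet_comap hfin)).trans (Drawing.ncard_crossSet_comap_le hfin)

theorem exists_crNum_eq_add (m j : ℕ) :
    ∃ (V : Type) (_ : Fintype V) (G : SimpleGraph V),
      crNum G = crNum (bundleGraph (4 * m)) + j ∧ (∃ D : Drawing G, D.CrossSet.Finite) ∧
      ∀ D : Drawing G, D.IsRectilinear → D.CrossSet.Finite → m ≤ D.CrossSet.ncard := by
  induction j with
  | zero =>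
    obtain ⟨D, hD, -⟩ := exists_drawing_bundleGraph (4 * m)
    exact ⟨_, inferInstance, bundleGraph (4 * m), rfl, ⟨D, hD⟩,
      fun D => le_ncard_crossSet_bundleGraph le_rfl D⟩
  | succ j ih =>
    obtain ⟨V, _, G, hG, h, hr⟩ := ih
    obtain ⟨h1, h2, h3⟩ := exists_sum_complete h hr
    exact ⟨_, inferInstance, _, by rw [h1, hG, add_assoc], h2, h3⟩

/-- Theorem. For all integers `k` and `m` with `m ≥ k ≥ 4`, there exists a finite
simple graph `G` such that `cr G = k` and `rcr G ≥ m`. -/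
theorem exists_graph_crNum_eq_and_rcrNum_ge (k m : ℕ) (hk : 4 ≤ k) (hm : k ≤ m) :
    ∃ (n : ℕ) (G : SimpleGraph (Fin n)), crNum G = k ∧ m ≤ rcrNum G := by
  obtain ⟨D₀, hD₀, h₀⟩ := exists_drawing_bundleGraph (4 * m)
  have hc := (crNum_le D₀ hD₀).trans h₀
  obtain ⟨V, _, G, hG, h, hr⟩ := exists_crNum_eq_add m (k - crNum (bundleGraph (4 * m)))
  let e := SimpleGraph.Iso.map (Fintype.equivFin V) G
  refine ⟨Fintype.card V, _, (crNum_congr e h).trans (by lia), ?_⟩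
  obtain ⟨E, hE, hfin⟩ := exists_isRectilinear_finite (G.map (Fintype.equivFin V).toEmbedding)
  refine le_csInf ⟨_, E, hE, hfin, rfl⟩ ?_
  rintro _ ⟨D, hD, hfin, rfl⟩
  exact (hr _ (hD.comap (φ := e.toHom) (hφ := e.injective))
    (Drawing.finite_crossSet_comap hfin)).trans (Drawing.ncard_crossSet_comap_le hfin)

end
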